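/- arXiv:0904.2756 — 3 statements merged into one kernel-verified Lean document; each statement's English description precedes it below -/
import Mathlib

section
/- For the real differential equation (2.1) ẋ = f(x,t) = x^n + P_{n−1}(t) x^{n−1} + ⋯ + P_1(t) x + P_0(t), the third derivative of the displacement function q at a real initial value c (for which the solution x(t,c) exists on [0,ω]) satisfies q‴(c) = E(ω,c) · [ (3/2)·(G(ω,c))^2 + ∫_0^ω (E(t,c))^2 · f_3(x(t,c),t) dt ], where E(t,c) = exp( ∫_0^t f_1(x(τ,c),τ) dτ ), D(t,c) = E(t,c) · f_2(x(t,c),t), G(t,c) = ∫_0^t D(τ,c) dτ, and f_i = ∂^i f/∂x^i. -/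
open Set Real Filter intervalIntegral

noncomputable section

/-- Right-hand side of the real equation (2.1):
`f(x,t) = x^n + P_{n-1}(t) x^{n-1} + ⋯ + P_1(t) x + P_0(t)`. -/
def fR (n : ℕ) (P : Fin n → ℝ → ℝ) (x t : ℝ) : ℝ :=
  x ^ n + ∑ i : Fin n, P i t * x ^ (i : ℕ)

/-- `f_k = ∂^k f / ∂x^k`. -/
def fDeriv (n : ℕ) (P : Fin n → ℝ → ℝ) (k : ℕ) (x t : ℝ) : ℝ :=
  iteratedDeriv k (fun y => fR n P y t) x

/-- `x` solves (2.1) on all of `[0, ω]`. -/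
def IsSolR (n : ℕ) (ω : ℝ) (P : Fin n → ℝ → ℝ) (x : ℝ → ℝ) : Prop :=
  ∀ t ∈ Icc (0:ℝ) ω, HasDerivWithinAt x (fR n P (x t) t) (Icc (0:ℝ) ω) t

/-- `E(t,c) = exp ∫₀ᵗ f₁(x(τ,c), τ) dτ`, for a given family of solutions `sol`. -/
def Efun (n : ℕ) (P : Fin n → ℝ → ℝ) (sol : ℝ → ℝ → ℝ) (t c : ℝ) : ℝ :=
  Real.exp (∫ τ in (0:ℝ)..t, fDeriv n P 1 (sol c τ) τ)

/-- `D(t,c) = E(t,c) · f₂(x(t,c), t)`. -/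
def Dfun (n : ℕ) (P : Fin n → ℝ → ℝ) (sol : ℝ → ℝ → ℝ) (t c : ℝ) : ℝ :=
  Efun n P sol t c * fDeriv n P 2 (sol c t) t

/-- `G(t,c) = ∫₀ᵗ D(τ,c) dτ`. -/
def Gfun (n : ℕ) (P : Fin n → ℝ → ℝ) (sol : ℝ → ℝ → ℝ) (t c : ℝ) : ℝ :=
  ∫ τ in (0:ℝ)..t, Dfun n P sol τ c

open scoped NNReal Topology

/-- The difference quotient of `fR` in the space variable, as a polynomial in both points. -/
def fQuot (n : ℕ) (P : Fin n → ℝ → ℝ) (x y t : ℝ) : ℝ :=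
  (∑ j ∈ Finset.range n, x ^ j * y ^ (n - 1 - j)) +
    ∑ i : Fin n, P i t * ∑ j ∈ Finset.range (i : ℕ), x ^ j * y ^ ((i : ℕ) - 1 - j)

section VectorField

variable {n : ℕ} {ω : ℝ} {P : Fin n → ℝ → ℝ}

lemma fQuot_mul_sub (x y t : ℝ) : fQuot n P x y t * (x - y) = fR n P x t - fR n P y t := by
  have h : ∀ k : ℕ, (∑ j ∈ Finset.range k, x ^ j * y ^ (k - 1 - j)) * (x - y) = x ^ k - y ^ k :=
    fun k => geom_sum₂_mul x y k
  simp only [fQuot, fR, add_mul, Finset.sum_mul, mul_assoc]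
  simp only [← mul_assoc, ← Finset.sum_mul, h]
  simp only [mul_sub, Finset.sum_sub_distrib]
  ring

lemma contDiff_fR (m : WithTop ℕ∞) (t : ℝ) : ContDiff ℝ m (fun y => fR n P y t) := by
  unfold fR
  fun_prop

lemma hasDerivAt_fDeriv (k : ℕ) (x t : ℝ) :
    HasDerivAt (fun y => fDeriv n P k y t) (fDeriv n P (k + 1) x t) x := by
  have h : Differentiable ℝ (iteratedDeriv k (fun y => fR n P y t)) :=
    (contDiff_fR ((k + 1 : ℕ) : WithTop ℕ∞) t).differentiable_iteratedDeriv k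
      (by exact_mod_cast Nat.lt_succ_self k)
  simpa only [fDeriv, iteratedDeriv_succ] using (h x).hasDerivAt

lemma fDeriv_eq (k : ℕ) (x t : ℝ) :
    fDeriv n P k x t = n.descFactorial k * x ^ (n - k) +
      ∑ i : Fin n, P i t * ((i : ℕ).descFactorial k * x ^ ((i : ℕ) - k)) := by
  have hpow : ∀ (m : ℕ) (y : ℝ), iteratedDeriv k (fun z : ℝ => z ^ m) y =
      m.descFactorial k * y ^ (m - k) := fun m y => by
    simp
  unfold fDeriv fR
  rw [iteratedDeriv_fun_add (by fun_prop) (by fun_prop), hpow, iteratedDeriv_fun_sum]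
  · simp only [iteratedDeriv_const_mul_field, hpow]
  · intro i _
    fun_prop

lemma fQuot_self (x t : ℝ) : fQuot n P x x t = fDeriv n P 1 x t := by
  simp [fQuot, fDeriv_eq, geom_sum₂_self]

variable (hP : ∀ i, ContinuousOn (P i) (Icc 0 ω))
include hP

lemma continuousOn_fDeriv (k : ℕ) :
    ContinuousOn (fun p : ℝ × ℝ => fDeriv n P k p.1 p.2) (univ ×ˢ Icc 0 ω) := by
  have hP' : ∀ i, ContinuousOn (fun p : ℝ × ℝ => P i p.2) (univ ×ˢ Icc 0 ω) := fun i =>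
    (hP i).comp continuousOn_snd fun _ hp => hp.2
  simp only [fDeriv_eq]
  refine ContinuousOn.add (by fun_prop) (continuousOn_finsetSum _ fun i _ => ?_)
  exact (hP' i).mul (by fun_prop)

lemma continuousOn_fQuot :
    ContinuousOn (fun p : (ℝ × ℝ) × ℝ => fQuot n P p.1.1 p.1.2 p.2) (univ ×ˢ Icc 0 ω) := by
  have hP' : ∀ i, ContinuousOn (fun p : (ℝ × ℝ) × ℝ => P i p.2) (univ ×ˢ Icc 0 ω) := fun i =>
    (hP i).comp continuousOn_snd fun _ hp => hp.2
  have hsum : ∀ k : ℕ, Continuous fun p : (ℝ × ℝ) × ℝ =>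
      ∑ j ∈ Finset.range k, p.1.1 ^ j * p.1.2 ^ (k - 1 - j) := fun k =>
    continuous_finsetSum _ fun j _ => by fun_prop
  unfold fQuot
  refine (hsum n).continuousOn.add (continuousOn_finsetSum _ fun i _ => ?_)
  exact (hP' i).mul (hsum i).continuousOn

lemma ContinuousOn.fDeriv_comp (k : ℕ) {x : ℝ → ℝ} (hx : ContinuousOn x (Icc 0 ω)) :
    ContinuousOn (fun t => fDeriv n P k (x t) t) (Icc 0 ω) :=
  (continuousOn_fDeriv hP k).comp (f := fun t => (x t, t)) (hx.prodMk continuousOn_id)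
    fun _ ht => ⟨trivial, ht⟩

lemma ContinuousOn.fQuot_comp {x y : ℝ → ℝ} (hx : ContinuousOn x (Icc 0 ω))
    (hy : ContinuousOn y (Icc 0 ω)) :
    ContinuousOn (fun t => fQuot n P (x t) (y t) t) (Icc 0 ω) :=
  (continuousOn_fQuot hP).comp (f := fun t => ((x t, y t), t))
    ((hx.prodMk hy).prodMk continuousOn_id) fun _ ht => ⟨trivial, ht⟩

lemma exists_bound_fDeriv (k : ℕ) (R : ℝ) :
    ∃ B, ∀ x t, |x| ≤ R → t ∈ Icc 0 ω → |fDeriv n P k x t| ≤ B := by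
  obtain ⟨B, hB⟩ := ((isCompact_Icc (a := -R) (b := R)).prod
    (isCompact_Icc (a := (0 : ℝ)) (b := ω))).exists_bound_of_continuousOn
    ((continuousOn_fDeriv hP k).mono (prod_mono (subset_univ _) subset_rfl))
  exact ⟨B, fun x t hx ht => hB (x, t) ⟨abs_le.1 hx, ht⟩⟩

lemma exists_bound_fQuot (R : ℝ) :
    ∃ B, ∀ x y t, |x| ≤ R → |y| ≤ R → t ∈ Icc 0 ω → |fQuot n P x y t| ≤ B := by
  obtain ⟨B, hB⟩ := (((isCompact_Icc (a := -R) (b := R)).prod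
    (isCompact_Icc (a := -R) (b := R))).prod
    (isCompact_Icc (a := (0 : ℝ)) (b := ω))).exists_bound_of_continuousOn
    ((continuousOn_fQuot hP).mono (prod_mono (subset_univ _) subset_rfl))
  exact ⟨B, fun x y t hx hy ht => hB ((x, y), t) ⟨⟨abs_le.1 hx, abs_le.1 hy⟩, ht⟩⟩

end VectorField

section Integrals

lemma ContinuousOn.hasDerivWithinAt_integral {f : ℝ → ℝ} {a b t : ℝ}
    (hf : ContinuousOn f (Icc a b)) (ht : t ∈ Icc a b) :
    HasDerivWithinAt (fun u => ∫ τ in a..u, f τ) (f t) (Icc a b) t := by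
  have hab : a ≤ b := ht.1.trans ht.2
  have hg : Continuous (IccExtend hab ((Icc a b).domRestrict f)) :=
    hf.domRestrict.Icc_extend'
  have hd := (hg.integral_hasStrictDerivAt a t).hasDerivAt.hasDerivWithinAt (s := Icc a b)
  rw [IccExtend_of_mem hab _ ht] at hd
  refine hd.congr_of_mem (fun u hu => ?_) ht
  refine intervalIntegral.integral_congr fun τ hτ => ?_
  rw [uIcc_of_le hu.1] at hτ
  exact (IccExtend_of_mem hab ((Icc a b).domRestrict f) (Icc_subset_Icc_right hu.2 hτ)).symm

lemma hasDerivAt_integral_of_bound {F F' : ℝ → ℝ → ℝ} {a b c B : ℝ}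
    (hF : ∀ᶠ u in 𝓝 c, ContinuousOn (F u) (uIcc a b))
    (hF' : ContinuousOn (F' c) (uIcc a b)) (hB : ∀ᶠ u in 𝓝 c, ∀ t ∈ uIcc a b, |F' u t| ≤ B)
    (hd : ∀ᶠ u in 𝓝 c, ∀ t ∈ uIcc a b, HasDerivAt (fun v => F v t) (F' u t) u) :
    HasDerivAt (fun u => ∫ t in a..b, F u t) (∫ t in a..b, F' c t) c := by
  refine (intervalIntegral.hasDerivAt_integral_of_dominated_loc_of_deriv_le (bound := fun _ => B)
    (hB.and hd) ?_ hF.self_of_nhds.intervalIntegrable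
    ((hF'.mono uIoc_subset_uIcc).aestronglyMeasurable measurableSet_uIoc) ?_
    intervalIntegrable_const ?_).2
  · filter_upwards [hF] with u hu
    exact (hu.mono uIoc_subset_uIcc).aestronglyMeasurable measurableSet_uIoc
  · exact .of_forall fun t ht u hu => hu.1 t (uIoc_subset_uIcc ht)
  · exact .of_forall fun t ht u hu => hu.2 t (uIoc_subset_uIcc ht)

lemma integral_mul_primitive {f : ℝ → ℝ} {a b : ℝ} (hab : a ≤ b)
    (hf : ContinuousOn f (Icc a b)) :
    ∫ t in a..b, f t * ∫ τ in a..t, f τ = (∫ t in a..b, f t) ^ 2 / 2 := by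
  have hd : ∀ t ∈ Icc a b, HasDerivWithinAt (fun u => (∫ τ in a..u, f τ) ^ 2 / 2)
      (f t * ∫ τ in a..t, f τ) (Icc a b) t := fun t ht => by
    refine (((hf.hasDerivWithinAt_integral ht).pow 2).div_const 2).congr_deriv ?_
    simp
    ring
  have hc : ContinuousOn (fun t => ∫ τ in a..t, f τ) (Icc a b) := fun t ht =>
    (hf.hasDerivWithinAt_integral ht).continuousWithinAt
  rw [intervalIntegral.integral_eq_sub_of_hasDerivAt_of_le hab
    (fun t ht => (hd t ht).continuousWithinAt)
    (fun t ht => (hd t (Ioo_subset_Icc_self ht)).hasDerivAt (Icc_mem_nhds ht.1 ht.2))]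
  · simp
  · rw [← uIcc_of_le hab] at hf hc
    exact (hf.mul hc).intervalIntegrable

end Integrals

section Solutions

variable {n : ℕ} {ω : ℝ} {P : Fin n → ℝ → ℝ}

lemma IsSolR.continuousOn {x : ℝ → ℝ} (hx : IsSolR n ω P x) : ContinuousOn x (Icc 0 ω) :=
  fun t ht => (hx t ht).continuousWithinAt

lemma IsSolR.sub_eq (hP : ∀ i, ContinuousOn (P i) (Icc 0 ω)) {x y : ℝ → ℝ}
    (hx : IsSolR n ω P x) (hy : IsSolR n ω P y) {t : ℝ} (ht : t ∈ Icc 0 ω) :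
    x t - y t = (x 0 - y 0) * Real.exp (∫ τ in (0 : ℝ)..t, fQuot n P (x τ) (y τ) τ) := by
  have hQ := ContinuousOn.fQuot_comp hP hx.continuousOn hy.continuousOn
  have hd : ∀ u ∈ Icc 0 ω, HasDerivWithinAt (fun u => (x u - y u) *
      Real.exp (-∫ τ in (0 : ℝ)..u, fQuot n P (x τ) (y τ) τ)) 0 (Icc 0 ω) u := fun u hu => by
    refine (((hx u hu).sub (hy u hu)).mul
      (hQ.hasDerivWithinAt_integral hu).neg.exp).congr_deriv ?_
    rw [← fQuot_mul_sub, Pi.sub_apply]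
    ring
  have h := constant_of_derivWithin_zero (fun u hu => (hd u hu).differentiableWithinAt)
    (fun u hu => (hd u (Ico_subset_Icc_self hu)).derivWithin
      (uniqueDiffOn_Icc (hu.1.trans_lt hu.2) u (Ico_subset_Icc_self hu))) t ht
  simp only [intervalIntegral.integral_same, neg_zero, Real.exp_zero, mul_one] at h
  rw [← h, mul_assoc, ← Real.exp_add]
  simp

/-- Picard–Lindelöf on the whole interval for a globally bounded, globally Lipschitz field,
together with the Grönwall estimate against a given solution. -/
lemma exists_solution_of_bounded_lipschitz {g : ℝ → ℝ → ℝ} {K L : ℝ≥0} (hω : 0 ≤ ω)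
    (hg : ∀ t ∈ Icc 0 ω, LipschitzWith K (g t)) (hc : ∀ y, ContinuousOn (g · y) (Icc 0 ω))
    (hL : ∀ t ∈ Icc 0 ω, ∀ y, |g t y| ≤ L) {x : ℝ → ℝ}
    (hx : ∀ t ∈ Icc 0 ω, HasDerivWithinAt x (g t (x t)) (Icc 0 ω) t) (c : ℝ) :
    ∃ y : ℝ → ℝ, y 0 = c ∧ (∀ t ∈ Icc 0 ω, HasDerivWithinAt y (g t (y t)) (Icc 0 ω) t) ∧
      ∀ t ∈ Icc 0 ω, |y t - x t| ≤ |c - x 0| * Real.exp (K * ω) := by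
  have hpl : IsPicardLindelof g (tmin := 0) (tmax := ω) ⟨0, le_rfl, hω⟩ c
      (L * ω.toNNReal) 0 L K :=
    ⟨fun t ht => (hg t ht).lipschitzOnWith, fun y _ => hc y, fun t ht y _ => hL t ht y, by
      simp [hω]⟩
  obtain ⟨y, hy0, hy⟩ := hpl.exists_eq_forall_mem_Icc_hasDerivWithinAt₀
  refine ⟨y, hy0, hy, fun t ht => ?_⟩
  have hright : ∀ z : ℝ → ℝ, (∀ t ∈ Icc 0 ω, HasDerivWithinAt z (g t (z t)) (Icc 0 ω) t) →
      ∀ t ∈ Ico 0 ω, HasDerivWithinAt z (g t (z t)) (Ici t) t := fun z hz t ht =>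
    (hz t (Ico_subset_Icc_self ht)).mono_of_mem_nhdsWithin (Icc_mem_nhdsGE_of_mem ht)
  have h := dist_le_of_trajectories_ODE_of_mem (v := g) (s := fun _ => univ)
    (fun t ht => (hg t (Ico_subset_Icc_self ht)).lipschitzOnWith)
    (fun t ht => (hy t ht).continuousWithinAt) (hright y hy) (fun _ _ => trivial)
    (fun t ht => (hx t ht).continuousWithinAt) (hright x hx) (fun _ _ => trivial) le_rfl t ht
  rw [Real.dist_eq, Real.dist_eq, show y 0 = c from hy0, sub_zero] at h
  refine h.trans (mul_le_mul_of_nonneg_left (Real.exp_le_exp.2 ?_) (abs_nonneg _))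
  exact mul_le_mul_of_nonneg_left ht.2 K.2

lemma IsSolR.exists_nearby (hω : 0 ≤ ω) (hP : ∀ i, ContinuousOn (P i) (Icc 0 ω)) {x : ℝ → ℝ}
    (hx : IsSolR n ω P x) :
    ∃ M, ∃ δ > 0, ∀ c, |c - x 0| < δ → ∃ y : ℝ → ℝ, IsSolR n ω P y ∧ y 0 = c ∧
      ∀ t ∈ Icc 0 ω, |y t - x t| ≤ |c - x 0| * M := by
  obtain ⟨R₀, hR₀⟩ := isCompact_Icc.exists_bound_of_continuousOn hx.continuousOn
  have hR₀0 : 0 ≤ R₀ := (norm_nonneg _).trans (hR₀ 0 ⟨le_rfl, hω⟩)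
  set R := R₀ + 1 with hR
  have hRR : -R ≤ R := by linarith
  obtain ⟨K, hK⟩ := exists_bound_fQuot hP R
  obtain ⟨L, hL⟩ := exists_bound_fDeriv hP 0 R
  have hclip : ∀ y : ℝ, |(projIcc (-R) R hRR y : ℝ)| ≤ R := fun y =>
    abs_le.2 (projIcc (-R) R hRR y).2
  have hclip_eq : ∀ y : ℝ, |y| ≤ R → (projIcc (-R) R hRR y : ℝ) = y := fun y hy => by
    rw [projIcc_of_mem hRR (abs_le.1 hy)]
  let g : ℝ → ℝ → ℝ := fun t y => fR n P (projIcc (-R) R hRR y) t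
  have hg : ∀ t ∈ Icc 0 ω, LipschitzWith K.toNNReal (g t) := fun t ht =>
    LipschitzWith.of_dist_le_mul fun y z => by
      rw [Real.dist_eq, Real.dist_eq, ← fQuot_mul_sub, abs_mul]
      have h1 := (LipschitzWith.projIcc hRR).dist_le_mul y z
      rw [NNReal.coe_one, one_mul, Subtype.dist_eq, Real.dist_eq, Real.dist_eq] at h1
      exact mul_le_mul ((hK _ _ t (hclip y) (hclip z) ht).trans (Real.le_coe_toNNReal K)) h1
        (abs_nonneg _) (NNReal.coe_nonneg _)
  have hc : ∀ y, ContinuousOn (g · y) (Icc 0 ω) := fun y => by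
    simpa [fDeriv] using ContinuousOn.fDeriv_comp hP 0
      (continuousOn_const (c := (projIcc (-R) R hRR y : ℝ)) (s := Icc 0 ω))
  have hL' : ∀ t ∈ Icc 0 ω, ∀ y, |g t y| ≤ L.toNNReal := fun t ht y =>
    (by simpa [fDeriv] using hL _ t (hclip y) ht : |g t y| ≤ L).trans (Real.le_coe_toNNReal L)
  have hxg : ∀ t ∈ Icc 0 ω, HasDerivWithinAt x (g t (x t)) (Icc 0 ω) t := fun t ht => by
    have : |x t| ≤ R := (hR₀ t ht).trans (by linarith)
    simpa only [g, hclip_eq _ this] using hx t ht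
  have hM : 0 < Real.exp (K.toNNReal * ω) := Real.exp_pos _
  refine ⟨Real.exp (K.toNNReal * ω), (Real.exp (K.toNNReal * ω))⁻¹, inv_pos.2 hM,
    fun c hcδ => ?_⟩
  obtain ⟨y, hy0, hy, hyx⟩ := exists_solution_of_bounded_lipschitz hω hg hc hL' hxg c
  refine ⟨y, fun t ht => ?_, hy0, hyx⟩
  have h1 : |c - x 0| * Real.exp (K.toNNReal * ω) ≤ 1 := by
    have := mul_le_mul_of_nonneg_right hcδ.le hM.le
    rwa [inv_mul_cancel₀ hM.ne'] at this
  have h2 : |y t| ≤ R := by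
    have h3 : |x t| ≤ R₀ := hR₀ t ht
    have h4 : |y t - x t| ≤ 1 := (hyx t ht).trans h1
    rw [abs_le] at *
    constructor <;> linarith
  simpa only [g, hclip_eq _ h2] using hy t ht

end Solutions

/-- `F u t` is bounded uniformly in `t ∈ [0, ω]` and in `u` near `c`. -/
def UniformlyBoundedNear (ω : ℝ) (F : ℝ → ℝ → ℝ) (c : ℝ) : Prop :=
  ∃ B, ∀ᶠ u in 𝓝 c, ∀ t ∈ Icc 0 ω, |F u t| ≤ B

namespace UniformlyBoundedNear

variable {ω c : ℝ} {F H : ℝ → ℝ → ℝ}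

lemma add (hF : UniformlyBoundedNear ω F c) (hH : UniformlyBoundedNear ω H c) :
    UniformlyBoundedNear ω (fun u t => F u t + H u t) c := by
  obtain ⟨B, hB⟩ := hF
  obtain ⟨C, hC⟩ := hH
  refine ⟨B + C, ?_⟩
  filter_upwards [hB, hC] with u hu hu' t ht
  exact (abs_add_le _ _).trans (add_le_add (hu t ht) (hu' t ht))

lemma mul (hF : UniformlyBoundedNear ω F c) (hH : UniformlyBoundedNear ω H c) :
    UniformlyBoundedNear ω (fun u t => F u t * H u t) c := by
  obtain ⟨B, hB⟩ := hF
  obtain ⟨C, hC⟩ := hH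
  refine ⟨B * C, ?_⟩
  filter_upwards [hB, hC] with u hu hu' t ht
  rw [abs_mul]
  exact mul_le_mul (hu t ht) (hu' t ht) (abs_nonneg _) ((abs_nonneg _).trans (hu t ht))

lemma exp (hF : UniformlyBoundedNear ω F c) :
    UniformlyBoundedNear ω (fun u t => Real.exp (F u t)) c := by
  obtain ⟨B, hB⟩ := hF
  refine ⟨Real.exp B, ?_⟩
  filter_upwards [hB] with u hu t ht
  rw [Real.abs_exp]
  exact Real.exp_le_exp.2 ((le_abs_self _).trans (hu t ht))

lemma integral (hF : UniformlyBoundedNear ω F c) :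
    UniformlyBoundedNear ω (fun u t => ∫ τ in (0 : ℝ)..t, F u τ) c := by
  obtain ⟨B, hB⟩ := hF
  refine ⟨B * ω, ?_⟩
  filter_upwards [hB] with u hu t ht
  have h := intervalIntegral.norm_integral_le_of_norm_le_const (a := 0) (b := t) (f := F u)
    (C := B) fun τ hτ => by
      rw [uIoc_of_le ht.1] at hτ
      exact hu τ ⟨hτ.1.le, hτ.2.trans ht.2⟩
  rw [sub_zero, abs_of_nonneg ht.1] at h
  exact h.trans (mul_le_mul_of_nonneg_left ht.2 ((abs_nonneg _).trans (hu t ht)))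

end UniformlyBoundedNear

/-- `sol` is the family of solutions of (2.1), and `Q` the set of initial values for which the
solution exists on `[0, ω]`. -/
structure IsSolFamily (n : ℕ) (ω : ℝ) (P : Fin n → ℝ → ℝ) (Q : Set ℝ) (sol : ℝ → ℝ → ℝ) :
    Prop where
  nonneg : 0 ≤ ω
  continuousOn_coeff : ∀ i, ContinuousOn (P i) (Icc 0 ω)
  mem_of_isSol : ∀ x, IsSolR n ω P x → x 0 ∈ Q
  isSol : ∀ c ∈ Q, IsSolR n ω P (sol c)
  initial : ∀ c ∈ Q, sol c 0 = c

namespace IsSolFamily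

variable {n : ℕ} {ω : ℝ} {P : Fin n → ℝ → ℝ} {Q : Set ℝ} {sol : ℝ → ℝ → ℝ} {c t : ℝ}
  (h : IsSolFamily n ω P Q sol)
include h

lemma eventually_abs_sub_le (hc : c ∈ Q) :
    ∃ M, ∀ᶠ u in 𝓝 c, u ∈ Q ∧ ∀ t ∈ Icc 0 ω, |sol u t - sol c t| ≤ |u - c| * M := by
  obtain ⟨M, δ, hδ, hM⟩ := (h.isSol c hc).exists_nearby h.nonneg h.continuousOn_coeff
  rw [h.initial c hc] at hM
  refine ⟨M, ?_⟩
  filter_upwards [Metric.ball_mem_nhds c hδ] with u hu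
  obtain ⟨y, hy, hy0, hyc⟩ := hM u hu
  have huQ : u ∈ Q := hy0 ▸ h.mem_of_isSol y hy
  refine ⟨huQ, fun t ht => ?_⟩
  have heq := (h.isSol u huQ).sub_eq h.continuousOn_coeff hy ht
  rw [h.initial u huQ, hy0, sub_self, zero_mul, sub_eq_zero] at heq
  rw [heq]
  exact hyc t ht

lemma mem_nhds (hc : c ∈ Q) : Q ∈ 𝓝 c :=
  let ⟨_, hM⟩ := h.eventually_abs_sub_le hc
  hM.mono fun _ hu => hu.1

lemma continuousAt_sol (hc : c ∈ Q) (ht : t ∈ Icc 0 ω) : ContinuousAt (fun u => sol u t) c := by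
  obtain ⟨M, hM⟩ := h.eventually_abs_sub_le hc
  refine tendsto_iff_dist_tendsto_zero.2 ?_
  refine squeeze_zero' (.of_forall fun _ => dist_nonneg) (hM.mono fun u hu => hu.2 t ht) ?_
  have hlim : ContinuousAt (fun u => |u - c| * M) c := by fun_prop
  simpa [ContinuousAt] using hlim

lemma uniformlyBoundedNear_sol (hc : c ∈ Q) : UniformlyBoundedNear ω sol c := by
  obtain ⟨M, hM⟩ := h.eventually_abs_sub_le hc
  obtain ⟨R, hR⟩ := isCompact_Icc.exists_bound_of_continuousOn (h.isSol c hc).continuousOn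
  have hlim : ∀ᶠ u in 𝓝 c, |u - c| * M < 1 := by
    have hcont : ContinuousAt (fun u => |u - c| * M) c := by fun_prop
    exact hcont.eventually_lt continuousAt_const (by simp)
  refine ⟨R + 1, ?_⟩
  filter_upwards [hM, hlim] with u hu hu' t ht
  have h1 := abs_sub_abs_le_abs_sub (sol u t) (sol c t)
  have h2 := hu.2 t ht
  have h3 : |sol c t| ≤ R := hR t ht
  linarith

lemma uniformlyBoundedNear_fDeriv (k : ℕ) (hc : c ∈ Q) :
    UniformlyBoundedNear ω (fun u t => fDeriv n P k (sol u t) t) c := by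
  obtain ⟨R, hR⟩ := h.uniformlyBoundedNear_sol hc
  obtain ⟨B, hB⟩ := exists_bound_fDeriv h.continuousOn_coeff k R
  exact ⟨B, hR.mono fun u hu t ht => hB _ t (hu t ht) ht⟩

lemma uniformlyBoundedNear_Efun (hc : c ∈ Q) :
    UniformlyBoundedNear ω (fun u t => Efun n P sol t u) c :=
  (h.uniformlyBoundedNear_fDeriv 1 hc).integral.exp

lemma uniformlyBoundedNear_Dfun (hc : c ∈ Q) :
    UniformlyBoundedNear ω (fun u t => Dfun n P sol t u) c :=
  (h.uniformlyBoundedNear_Efun hc).mul (h.uniformlyBoundedNear_fDeriv 2 hc)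

lemma uniformlyBoundedNear_Gfun (hc : c ∈ Q) :
    UniformlyBoundedNear ω (fun u t => Gfun n P sol t u) c :=
  (h.uniformlyBoundedNear_Dfun hc).integral

lemma continuousOn_fDeriv_sol (k : ℕ) (hc : c ∈ Q) :
    ContinuousOn (fun t => fDeriv n P k (sol c t) t) (Icc 0 ω) :=
  ContinuousOn.fDeriv_comp h.continuousOn_coeff k (h.isSol c hc).continuousOn

lemma continuousOn_Efun (hc : c ∈ Q) : ContinuousOn (fun t => Efun n P sol t c) (Icc 0 ω) :=
  fun _ ht => ((h.continuousOn_fDeriv_sol 1 hc).hasDerivWithinAt_integral ht).exp.continuousWithinAt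

lemma continuousOn_Dfun (hc : c ∈ Q) : ContinuousOn (fun t => Dfun n P sol t c) (Icc 0 ω) :=
  (h.continuousOn_Efun hc).mul (h.continuousOn_fDeriv_sol 2 hc)

lemma continuousOn_Gfun (hc : c ∈ Q) : ContinuousOn (fun t => Gfun n P sol t c) (Icc 0 ω) :=
  fun _ ht => ((h.continuousOn_Dfun hc).hasDerivWithinAt_integral ht).continuousWithinAt

lemma hasDerivAt_sol (hc : c ∈ Q) (ht : t ∈ Icc 0 ω) :
    HasDerivAt (fun u => sol u t) (Efun n P sol t c) c := by
  have hsub : uIcc 0 t ⊆ Icc 0 ω := by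
    rw [uIcc_of_le ht.1]
    exact Icc_subset_Icc_right ht.2
  obtain ⟨R, hR⟩ := h.uniformlyBoundedNear_sol hc
  obtain ⟨B, hB⟩ := exists_bound_fQuot h.continuousOn_coeff R
  have hint : ContinuousAt
      (fun u => ∫ τ in (0 : ℝ)..t, fQuot n P (sol u τ) (sol c τ) τ) c := by
    refine intervalIntegral.continuousAt_of_dominated_interval (bound := fun _ => B) ?_ ?_
      intervalIntegrable_const ?_
    · filter_upwards [h.mem_nhds hc] with u hu
      exact ((ContinuousOn.fQuot_comp h.continuousOn_coeff (h.isSol u hu).continuousOn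
        (h.isSol c hc).continuousOn).mono (uIoc_subset_uIcc.trans hsub)).aestronglyMeasurable
        measurableSet_uIoc
    · filter_upwards [hR] with u hu
      refine .of_forall fun τ hτ => ?_
      have hτ' := hsub (uIoc_subset_uIcc hτ)
      exact hB _ _ τ (hu τ hτ') (hR.self_of_nhds τ hτ') hτ'
    · refine .of_forall fun τ hτ => ?_
      have hτ' := hsub (uIoc_subset_uIcc hτ)
      have hx := h.continuousAt_sol hc hτ'
      have hq : Continuous fun x => fQuot n P x (sol c τ) τ := by
        unfold fQuot
        fun_prop
      exact hq.continuousAt.comp (f := fun u => sol u τ) hx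
  have hlim := (Real.continuous_exp.continuousAt.comp hint).tendsto
  rw [hasDerivAt_iff_tendsto_slope]
  simp only [Function.comp_def, fQuot_self] at hlim
  refine (hlim.mono_left nhdsWithin_le_nhds).congr' ?_
  filter_upwards [self_mem_nhdsWithin, nhdsWithin_le_nhds (h.mem_nhds hc)] with u hne hu
  have heq := (h.isSol u hu).sub_eq h.continuousOn_coeff (h.isSol c hc) ht
  rw [h.initial u hu, h.initial c hc] at heq
  rw [slope_def_field, heq, mul_div_cancel_left₀ _ (sub_ne_zero.2 hne)]

lemma hasDerivAt_fDeriv_sol (k : ℕ) (hc : c ∈ Q) (ht : t ∈ Icc 0 ω) :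
    HasDerivAt (fun u => fDeriv n P k (sol u t) t)
      (fDeriv n P (k + 1) (sol c t) t * Efun n P sol t c) c :=
  (hasDerivAt_fDeriv k (sol c t) t).comp c (h.hasDerivAt_sol hc ht)

lemma hasDerivAt_integral {F F' : ℝ → ℝ → ℝ} (hF : ∀ u ∈ Q, ContinuousOn (F u) (Icc 0 ω))
    (hF' : ContinuousOn (F' c) (Icc 0 ω)) (hB : UniformlyBoundedNear ω F' c)
    (hd : ∀ u ∈ Q, ∀ t ∈ Icc 0 ω, HasDerivAt (fun v => F v t) (F' u t) u) (hc : c ∈ Q)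
    (ht : t ∈ Icc 0 ω) :
    HasDerivAt (fun u => ∫ τ in (0 : ℝ)..t, F u τ) (∫ τ in (0 : ℝ)..t, F' c τ) c := by
  have hsub : uIcc 0 t ⊆ Icc 0 ω := by
    rw [uIcc_of_le ht.1]
    exact Icc_subset_Icc_right ht.2
  have hQ : ∀ᶠ u in 𝓝 c, u ∈ Q := h.mem_nhds hc
  obtain ⟨B, hB⟩ := hB
  exact hasDerivAt_integral_of_bound (hQ.mono fun u hu => (hF u hu).mono hsub) (hF'.mono hsub)
    (hB.mono fun u hu τ hτ => hu τ (hsub hτ)) (hQ.mono fun u hu τ hτ => hd u hu τ (hsub hτ))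

lemma hasDerivAt_Efun (hc : c ∈ Q) (ht : t ∈ Icc 0 ω) :
    HasDerivAt (fun u => Efun n P sol t u) (Efun n P sol t c * Gfun n P sol t c) c :=
  (h.hasDerivAt_integral (F' := fun u τ => Dfun n P sol τ u)
    (fun _ hu => h.continuousOn_fDeriv_sol 1 hu) (h.continuousOn_Dfun hc)
    (h.uniformlyBoundedNear_Dfun hc)
    (fun _ hu _ hτ => (h.hasDerivAt_fDeriv_sol 1 hu hτ).congr_deriv (mul_comm _ _)) hc ht).exp

lemma hasDerivAt_Gfun (hc : c ∈ Q) (ht : t ∈ Icc 0 ω) :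
    HasDerivAt (fun u => Gfun n P sol t u) ((Gfun n P sol t c) ^ 2 / 2 +
      ∫ τ in (0 : ℝ)..t, (Efun n P sol τ c) ^ 2 * fDeriv n P 3 (sol c τ) τ) c := by
  have hsub : uIcc 0 t ⊆ Icc 0 ω := by
    rw [uIcc_of_le ht.1]
    exact Icc_subset_Icc_right ht.2
  have hDG : ContinuousOn (fun τ => Dfun n P sol τ c * Gfun n P sol τ c) (Icc 0 ω) :=
    (h.continuousOn_Dfun hc).mul (h.continuousOn_Gfun hc)
  have hEf : ContinuousOn (fun τ => Efun n P sol τ c * Efun n P sol τ c *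
      fDeriv n P 3 (sol c τ) τ) (Icc 0 ω) :=
    ((h.continuousOn_Efun hc).mul (h.continuousOn_Efun hc)).mul (h.continuousOn_fDeriv_sol 3 hc)
  have hE := h.uniformlyBoundedNear_Efun hc
  refine (h.hasDerivAt_integral (F' := fun u τ => Dfun n P sol τ u * Gfun n P sol τ u +
    Efun n P sol τ u * Efun n P sol τ u * fDeriv n P 3 (sol u τ) τ)
    (fun _ hu => h.continuousOn_Dfun hu) (hDG.add hEf)
    (((h.uniformlyBoundedNear_Dfun hc).mul (h.uniformlyBoundedNear_Gfun hc)).add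
      ((hE.mul hE).mul (h.uniformlyBoundedNear_fDeriv 3 hc)))
    (fun u hu τ hτ => ((h.hasDerivAt_Efun hu hτ).mul
      (h.hasDerivAt_fDeriv_sol 2 hu hτ)).congr_deriv ?_) hc ht).congr_deriv ?_
  · rw [Dfun]
    ring
  · rw [intervalIntegral.integral_add (hDG.mono hsub).intervalIntegrable
      (hEf.mono hsub).intervalIntegrable]
    simp only [pow_two (Efun _ _ _ _ _)]
    congr 1
    exact integral_mul_primitive ht.1
      ((h.continuousOn_Dfun hc).mono (Icc_subset_Icc_right ht.2))

end IsSolFamily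

/-- Lemma 2.2 (third derivative):
`q‴(c) = E(ω,c) · [ (3/2)·G(ω,c)² + ∫₀^ω E(t,c)² · f₃(x(t,c), t) dt ]`. -/
theorem displacement_third_derivative
    {n : ℕ} (hn : 2 ≤ n) {ω : ℝ} (hω : 0 < ω)
    (P : Fin n → ℝ → ℝ) (hP : ∀ i, ContinuousOn (P i) (Icc 0 ω))
    -- `Q` is the set of initial values whose solution exists on all of `[0, ω]`
    (Q : Set ℝ) (hQ : ∀ c, c ∈ Q ↔ ∃ x : ℝ → ℝ, IsSolR n ω P x ∧ x 0 = c)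
    -- `sol c` is the solution with initial value `c`
    (sol : ℝ → ℝ → ℝ)
    (hsol : ∀ c ∈ Q, IsSolR n ω P (sol c) ∧ sol c 0 = c)
    -- `q` is the displacement function
    (q : ℝ → ℝ) (hq : ∀ c ∈ Q, q c = sol c ω - c)
    (c : ℝ) (hc : c ∈ Q) :
    HasDerivAt (iteratedDeriv 2 q)
      (Efun n P sol ω c * ((3/2) * (Gfun n P sol ω c) ^ 2 +
        ∫ t in (0:ℝ)..ω, (Efun n P sol t c) ^ 2 * fDeriv n P 3 (sol c t) t)) c := by
  have h : IsSolFamily n ω P Q sol :=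
    ⟨hω.le, hP, fun x hx => (hQ _).2 ⟨x, hx, rfl⟩, fun c hc => (hsol c hc).1,
      fun c hc => (hsol c hc).2⟩
  have hmem : ω ∈ Icc 0 ω := ⟨hω.le, le_rfl⟩
  have hev : ∀ {u}, u ∈ Q → ∀ᶠ v in 𝓝 u, v ∈ Q := fun hu => h.mem_nhds hu
  have h1 : ∀ u ∈ Q, deriv q u = Efun n P sol ω u - 1 := fun u hu =>
    (((h.hasDerivAt_sol hu hmem).sub (hasDerivAt_id u)).congr_of_eventuallyEq
      ((hev hu).mono hq)).deriv
  have h2 : ∀ u ∈ Q, iteratedDeriv 2 q u = Efun n P sol ω u * Gfun n P sol ω u := fun u hu => by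
    rw [iteratedDeriv_succ, iteratedDeriv_one]
    exact (((h.hasDerivAt_Efun hu hmem).sub_const 1).congr_of_eventuallyEq
      ((hev hu).mono h1)).deriv
  refine (((h.hasDerivAt_Efun hc hmem).mul (h.hasDerivAt_Gfun hc hmem)).congr_of_eventuallyEq
    ((hev hc).mono h2)).congr_deriv ?_
  ring
end
end

section
/- Let n ≥ 2, let ω > 0, and let P_1 : [0,ω] → ℝ be continuous. The equation dz/dt = z^n + P_1(t) z has exactly n complex periodic solutions counted with multiplicity. -/
open Set Real Filter

noncomputable section

/-- `z` is a (complex-valued) solution of `dz/dt = z^n + P₁(t) z` on all of `[0, ω]`. -/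
def IsSolLin (n : ℕ) (ω : ℝ) (P1 : ℝ → ℝ) (z : ℝ → ℂ) : Prop :=
  ∀ t ∈ Icc (0:ℝ) ω, HasDerivWithinAt z ((z t) ^ n + (P1 t : ℂ) * z t) (Icc (0:ℝ) ω) t

/-- `q` has a zero of order exactly `k` at `c`. -/
def HasZeroOfOrder (q : ℂ → ℂ) (c : ℂ) (k : ℕ) : Prop :=
  ∃ g : ℂ → ℂ, AnalyticAt ℂ g c ∧ g c ≠ 0 ∧ ∀ᶠ w in nhds c, q w = (w - c) ^ k * g w

/-- The displacement function of the Bernoulli equation in closed form, with `A = ∫₀^ω P₁` and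
`B = m ∫₀^ω exp (m ∫₀^t P₁) dt`. -/
def bernoulliDisplacement (m : ℕ) (A B : ℝ) (c : ℂ) : ℂ :=
  c * ((Real.exp A : ℂ) * (1 - (B : ℂ) * c ^ m) ^ (-(1 / m : ℂ)) - 1)

/-- Explicit solutions of the Bernoulli equation. -/
theorem isSolLin_bernoulli {m : ℕ} (hm : m ≠ 0) {ω : ℝ} {P1 A B : ℝ → ℝ}
    (hA : ∀ t ∈ Icc 0 ω, HasDerivAt A (P1 t) t)
    (hB : ∀ t ∈ Icc 0 ω, HasDerivAt B (m * Real.exp (m * A t)) t) {c : ℂ}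
    (hc : ∀ t ∈ Icc 0 ω, 1 - (B t : ℂ) * c ^ m ∈ Complex.slitPlane) :
    IsSolLin (m + 1) ω P1
      (fun t => c * ((Real.exp (A t) : ℂ) * (1 - (B t : ℂ) * c ^ m) ^ (-(1 / m : ℂ)))) := by
  intro t ht
  have hm' : (m : ℂ) ≠ 0 := Nat.cast_ne_zero.mpr hm
  have hW : HasDerivAt (fun s => 1 - (B s : ℂ) * c ^ m)
      (-(((m * Real.exp (m * A t) : ℝ) : ℂ) * c ^ m)) t :=
    ((hB t ht).ofReal_comp.mul_const _).const_sub 1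
  have hne : (1 - (B t : ℂ) * c ^ m) ≠ 0 := Complex.slitPlane_ne_zero (hc t ht)
  have hpow := (Complex.hasStrictDerivAt_cpow_const (c := -(1 / m : ℂ))
    (hc t ht)).hasDerivAt.comp_hasDerivWithinAt t (hW.hasDerivWithinAt (s := Icc 0 ω))
  have hE := ((hA t ht).exp.ofReal_comp).hasDerivWithinAt (s := Icc 0 ω)
  have hz := (hE.mul hpow).const_mul c
  refine hz.congr_deriv ?_
  simp only [Function.comp_apply]
  generalize 1 - (B t : ℂ) * c ^ m = W at hne ⊢
  have hWm : (W ^ (-(1 / m : ℂ))) ^ m = W⁻¹ := by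
    rw [← Complex.cpow_mul_nat, neg_mul, one_div, inv_mul_cancel₀ hm', Complex.cpow_neg_one]
  rw [Complex.cpow_sub _ _ hne, Complex.cpow_one, mul_comm (m : ℝ) (A t), Real.exp_mul,
    Real.rpow_natCast]
  push_cast
  rw [pow_succ, mul_pow, mul_pow, hWm]
  generalize W ^ (-(1 / m : ℂ)) = V
  generalize Complex.exp (A t) = E
  field_simp
  ring

/-- First integral of the Bernoulli equation. -/
theorem IsSolLin.bernoulli_first_integral {m : ℕ} {ω : ℝ} (hω : 0 ≤ ω) {P1 A B : ℝ → ℝ}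
    (hP1 : ContinuousOn P1 (Icc 0 ω)) (hA : ∀ t ∈ Icc 0 ω, HasDerivAt A (P1 t) t)
    (hB : ∀ t ∈ Icc 0 ω, HasDerivAt B (m * Real.exp (m * A t)) t)
    (hA0 : A 0 = 0) (hB0 : B 0 = 0) {z : ℝ → ℂ} (hz : IsSolLin (m + 1) ω P1 z) :
    z ω ^ m * (1 - (B ω : ℂ) * z 0 ^ m) = (Real.exp (m * A ω) : ℂ) * z 0 ^ m := by
  set c := z 0 with hc
  set g : ℝ → ℂ := fun t =>
    z t ^ m * (1 - (B t : ℂ) * c ^ m) - (Real.exp (m * A t) : ℂ) * c ^ m with hg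
  have hzc : ContinuousOn z (Icc 0 ω) := fun t ht => (hz t ht).continuousWithinAt
  have hgd : ∀ t ∈ Icc 0 ω, HasDerivWithinAt g (m * (z t ^ m + (P1 t : ℂ)) * g t) (Icc 0 ω) t := by
    intro t ht
    have h1 := (hz t ht).pow m
    have h2 : HasDerivAt (fun s => 1 - (B s : ℂ) * c ^ m)
        (-(((m * Real.exp (m * A t) : ℝ) : ℂ) * c ^ m)) t :=
      ((hB t ht).ofReal_comp.mul_const _).const_sub 1
    have h3 := (((hA t ht).const_mul (m : ℝ)).exp.ofReal_comp).mul_const (c ^ m)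
    refine ((h1.mul h2.hasDerivWithinAt).sub h3.hasDerivWithinAt).congr_deriv ?_
    simp only [hg, Pi.pow_apply]
    push_cast
    rcases m with _ | m
    · simp
    · simp only [Nat.add_sub_cancel]
      push_cast
      ring
  obtain ⟨K, hK⟩ := isCompact_Icc.exists_bound_of_continuousOn
    (f := fun t => (m : ℂ) * (z t ^ m + (P1 t : ℂ))) (s := Icc 0 ω)
    (continuousOn_const.mul ((hzc.pow m).add (Complex.continuous_ofReal.comp_continuousOn hP1)))
  have h0 := eq_zero_of_abs_deriv_le_mul_abs_self_of_eq_zero_right (a := 0) (b := ω) (K := K)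
    (fun t ht => (hgd t ht).continuousWithinAt)
    (fun t ht => (hgd t (Ico_subset_Icc_self ht)).mono_of_mem_nhdsWithin
      (Icc_mem_nhdsGE_of_mem ht))
    (by simp [hg, hA0, hB0, hc])
    (fun t ht => by
      rw [norm_mul]
      exact mul_le_mul_of_nonneg_right (hK t (Ico_subset_Icc_self ht)) (norm_nonneg _))
    ω (right_mem_Icc.mpr hω)
  exact sub_eq_zero.mp h0

theorem HasZeroOfOrder.congr {f g : ℂ → ℂ} {c : ℂ} {k : ℕ} (hf : HasZeroOfOrder f c k)
    (h : g =ᶠ[nhds c] f) : HasZeroOfOrder g c k := by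
  obtain ⟨u, hu, hu0, hfu⟩ := hf
  exact ⟨u, hu, hu0, by filter_upwards [h, hfu] with w h1 h2 using h1.trans h2⟩

theorem hasZeroOfOrder_one {f : ℂ → ℂ} {c f' : ℂ} (hf : AnalyticAt ℂ f c) (h0 : f c = 0)
    (hd : HasDerivAt f f' c) (hf' : f' ≠ 0) : HasZeroOfOrder f c 1 := by
  obtain ⟨p, hp⟩ := hf
  refine ⟨dslope f c, ⟨_, hp.has_fpower_series_dslope_fslope⟩, by rwa [dslope_same, hd.deriv],
    Eventually.of_forall fun w => ?_⟩
  rw [pow_one, ← smul_eq_mul, sub_smul_dslope, h0, sub_zero]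

theorem analyticAt_one_sub_mul_cpow {B : ℝ} {a v : ℂ} (hv : 1 - (B : ℂ) * v ∈ Complex.slitPlane) :
    AnalyticAt ℂ (fun v : ℂ => (1 - (B : ℂ) * v) ^ a) v :=
  AnalyticAt.cpow (by fun_prop) analyticAt_const hv

theorem hasDerivAt_one_sub_mul_cpow {B : ℝ} {a v : ℂ} (hv : 1 - (B : ℂ) * v ∈ Complex.slitPlane) :
    HasDerivAt (fun v : ℂ => (1 - (B : ℂ) * v) ^ a) (a * (1 - B * v) ^ (a - 1) * -B) v := by
  have h : HasDerivAt (fun v : ℂ => 1 - (B : ℂ) * v) (-(B : ℂ)) v := by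
    simpa using ((hasDerivAt_id v).const_mul (B : ℂ)).const_sub 1
  exact h.cpow_const hv

/-- If `A = 0`, the origin is a zero of order `m + 1` of the displacement function. -/
theorem hasZeroOfOrder_bernoulliDisplacement_of_eq_zero {m : ℕ} (hm : m ≠ 0) {B : ℝ}
    (hB : B ≠ 0) : HasZeroOfOrder (bernoulliDisplacement m 0 B) 0 (m + 1) := by
  have hs : 1 - (B : ℂ) * 0 ∈ Complex.slitPlane := by simp
  obtain ⟨g, hg, hg0, hfg⟩ := hasZeroOfOrder_one (c := 0)
    (f := fun v : ℂ => (1 - (B : ℂ) * v) ^ (-(1 / m : ℂ)) - 1)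
    ((analyticAt_one_sub_mul_cpow hs).sub analyticAt_const) (by simp)
    ((hasDerivAt_one_sub_mul_cpow hs).sub_const 1) (by simp [hm, hB])
  have h0 : (0 : ℂ) ^ m = 0 := zero_pow hm
  have ht : Tendsto (fun c : ℂ => c ^ m) (nhds 0) (nhds 0) := by
    simpa [h0] using (continuous_pow m).tendsto (0 : ℂ)
  refine ⟨fun c => g (c ^ m), ?_, by simpa [h0] using hg0, ?_⟩
  · exact AnalyticAt.comp (g := g) (f := fun c : ℂ => c ^ m) (by rwa [h0]) (by fun_prop)
  · filter_upwards [ht.eventually hfg] with w hw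
    simp only [bernoulliDisplacement, Real.exp_zero, Complex.ofReal_one, one_mul, hw]
    ring

theorem bernoulliDisplacement_eq_zero {m : ℕ} (hm : m ≠ 0) {A B : ℝ} {c : ℂ}
    (hc : c = 0 ∨ (B : ℂ) * c ^ m = 1 - Real.exp (m * A)) :
    bernoulliDisplacement m A B c = 0 := by
  rcases hc with rfl | hc
  · simp [bernoulliDisplacement]
  · have hm' : (m : ℝ) ≠ 0 := Nat.cast_ne_zero.mpr hm
    have h : ((Real.exp (m * A) : ℝ) : ℂ) ^ (-(1 / m : ℂ)) = (Real.exp (-A) : ℝ) := by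
      have := Complex.ofReal_cpow (Real.exp_pos (m * A)).le (-(1 / m : ℝ))
      push_cast [← Real.exp_mul] at this ⊢
      rw [← this]
      congr 1
      have hm'' : (m : ℂ) ≠ 0 := by exact_mod_cast hm'
      field_simp
    rw [bernoulliDisplacement, hc, sub_sub_cancel, h, ← Complex.ofReal_mul, ← Real.exp_add]
    simp

theorem one_sub_mul_pow_mem_slitPlane {m : ℕ} (hm : m ≠ 0) {A B : ℝ} {c : ℂ}
    (hc : c = 0 ∨ (B : ℂ) * c ^ m = 1 - Real.exp (m * A)) :
    1 - (B : ℂ) * c ^ m ∈ Complex.slitPlane := by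
  rcases hc with rfl | hc
  · simp [hm]
  · rw [hc, sub_sub_cancel, Complex.ofReal_mem_slitPlane]
    exact Real.exp_pos _

theorem hasZeroOfOrder_bernoulliDisplacement_one {m : ℕ} (hm : m ≠ 0) {A B : ℝ}
    (hA : A ≠ 0) (hB : B ≠ 0) {c : ℂ} (hc : c = 0 ∨ (B : ℂ) * c ^ m = 1 - Real.exp (m * A)) :
    HasZeroOfOrder (bernoulliDisplacement m A B) c 1 := by
  have hm' : (m : ℂ) ≠ 0 := Nat.cast_ne_zero.mpr hm
  set F : ℂ → ℂ := fun c =>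
    (Real.exp A : ℂ) * (1 - (B : ℂ) * c ^ m) ^ (-(1 / m : ℂ)) - 1 with hF
  have hs : 1 - (B : ℂ) * c ^ m ∈ Complex.slitPlane := one_sub_mul_pow_mem_slitPlane hm hc
  have hFa : AnalyticAt ℂ F c :=
    (analyticAt_const.mul (AnalyticAt.comp (g := fun v : ℂ => (1 - (B : ℂ) * v) ^ (-(1 / m : ℂ)))
      (f := fun c : ℂ => c ^ m) (analyticAt_one_sub_mul_cpow hs) (by fun_prop))).sub
      analyticAt_const
  have hpow : HasDerivAt (fun c : ℂ => c ^ m) (m * c ^ (m - 1)) c := hasDerivAt_pow m c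
  have hFd := (((hasDerivAt_one_sub_mul_cpow (a := -(1 / m : ℂ)) hs).comp c hpow).const_mul
    (Real.exp A : ℂ)).sub_const 1
  refine hasZeroOfOrder_one (f := bernoulliDisplacement m A B) (analyticAt_id.mul hFa)
    (bernoulliDisplacement_eq_zero hm hc) ((hasDerivAt_id c).mul hFd) ?_
  rcases eq_or_ne c 0 with rfl | hc0
  · simp only [id, zero_mul, add_zero, one_mul, zero_pow hm, mul_zero, sub_zero,
      Complex.one_cpow, mul_one, ne_eq, sub_eq_zero]
    exact_mod_cast fun h => hA (Real.exp_eq_one_iff A |>.mp h)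
  · have hz := bernoulliDisplacement_eq_zero hm hc
    have hz' := (mul_eq_zero.mp hz).resolve_left hc0
    simp only [id, one_mul, hz', zero_add]
    have hW := Complex.slitPlane_ne_zero hs
    refine mul_ne_zero hc0 (mul_ne_zero (Complex.ofReal_ne_zero.mpr (Real.exp_ne_zero A))
      (mul_ne_zero (mul_ne_zero (mul_ne_zero ?_ ?_) ?_) (mul_ne_zero hm' (pow_ne_zero _ hc0))))
    · simpa using hm
    · simp [Complex.cpow_eq_zero_iff, hW]
    · simpa using hB

/-- A nonzero complex number has `m` distinct `m`-th roots, all different from `0`. -/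
theorem card_insert_zero_nthRootsFinset {m : ℕ} (hm : m ≠ 0) {a : ℂ} (ha : a ≠ 0) :
    (insert 0 (Polynomial.nthRootsFinset m a)).card = m + 1 := by
  have hζ := Complex.isPrimitiveRoot_exp m hm
  rw [Finset.card_insert_of_notMem, Polynomial.nthRootsFinset_def,
    Multiset.toFinset_card_of_nodup (hζ.nthRoots_nodup ha), hζ.card_nthRoots,
    if_pos (IsAlgClosed.exists_pow_nat_eq a (Nat.pos_of_ne_zero hm))]
  rw [Polynomial.mem_nthRootsFinset (Nat.pos_of_ne_zero hm), zero_pow hm]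
  exact ha.symm

/-- Primitives of `P` and of the coefficient of the Bernoulli equation. -/
theorem exists_bernoulli_primitives (m : ℕ) {ω : ℝ} (hω : 0 ≤ ω) {P : ℝ → ℝ}
    (hP : ContinuousOn P (Icc 0 ω)) :
    ∃ A B : ℝ → ℝ, A 0 = 0 ∧ B 0 = 0 ∧ (∀ t ∈ Icc 0 ω, HasDerivAt A (P t) t) ∧
      ∀ t, HasDerivAt B (m * Real.exp (m * A t)) t := by
  have hc : Continuous (IccExtend hω ((Icc 0 ω).domRestrict P)) :=
    hP.domRestrict.Icc_extend'
  set A : ℝ → ℝ := fun t => ∫ s in (0 : ℝ)..t, IccExtend hω ((Icc 0 ω).domRestrict P) s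
  have hA : ∀ t, HasDerivAt A (IccExtend hω ((Icc 0 ω).domRestrict P) t) t :=
    fun t => hc.integral_hasStrictDerivAt 0 t |>.hasDerivAt
  have hAc : Continuous A := continuous_iff_continuousAt.mpr fun t => (hA t).continuousAt
  have hBc : Continuous fun t => (m : ℝ) * Real.exp (m * A t) := by fun_prop
  refine ⟨A, fun t => ∫ s in (0 : ℝ)..t, m * Real.exp (m * A s), by simp [A], by simp,
    fun t ht => ?_, fun t => (hBc.integral_hasStrictDerivAt 0 t).hasDerivAt⟩
  simpa [IccExtend_of_mem hω _ ht] using hA t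

/-- The equation `dz/dt = z^n + P₁(t) z` has exactly `n` complex periodic solutions
counted with multiplicity. -/
theorem power_plus_linear_has_n_periodic_solutions
    {n : ℕ} (hn : 2 ≤ n) {ω : ℝ} (hω : 0 < ω)
    (P1 : ℝ → ℝ) (hP1 : ContinuousOn P1 (Icc 0 ω))
    -- `Q` is the set of initial values whose solution exists on all of `[0, ω]`
    (Q : Set ℂ) (hQ : ∀ c, c ∈ Q ↔ ∃ z : ℝ → ℂ, IsSolLin n ω P1 z ∧ z 0 = c)
    -- `q` is the displacement function
    (q : ℂ → ℂ)
    (hq : ∀ (c : ℂ) (z : ℝ → ℂ), IsSolLin n ω P1 z → z 0 = c → q c = z ω - c) :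
    ∃ (S : Finset ℂ) (mult : ℂ → ℕ),
      (↑S : Set ℂ) ⊆ Q ∧
      (∀ c ∈ Q, (q c = 0 ↔ c ∈ S)) ∧
      (∀ c ∈ S, 1 ≤ mult c ∧ HasZeroOfOrder q c (mult c)) ∧
      ∑ c ∈ S, mult c = n := by
  obtain ⟨m, rfl⟩ : ∃ m, n = m + 1 := ⟨n - 1, by omega⟩
  have hm : m ≠ 0 := by omega
  obtain ⟨A, B, hA0, hB0, hA, hB⟩ := exists_bernoulli_primitives m hω.le hP1
  have hBmono : StrictMono B := strictMono_of_hasDerivAt_pos hB fun t => by positivity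
  have hBω : 0 < B ω := hB0 ▸ hBmono hω
  have hslit : ∀ c : ℂ, 1 - (B ω : ℂ) * c ^ m ∈ Complex.slitPlane →
      c ∈ Q ∧ q c = bernoulliDisplacement m (A ω) (B ω) c := by
    intro c hc
    have hc' : ∀ t ∈ Icc 0 ω, 1 - (B t : ℂ) * c ^ m ∈ Complex.slitPlane := by
      intro t ht
      have hBt : 0 ≤ B t := hB0 ▸ hBmono.monotone ht.1
      have h := Complex.starConvex_one_slitPlane.add_smul_mem (y := -((B ω : ℂ) * c ^ m))
        (by simpa [sub_eq_add_neg] using hc) (t := B t / B ω) (by positivity)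
        ((div_le_one hBω).mpr (hBmono.monotone ht.2))
      convert h using 1
      have : (B ω : ℂ) ≠ 0 := by exact_mod_cast hBω.ne'
      rw [Complex.real_smul, Complex.ofReal_div]
      field_simp
      ring
    have hsol := isSolLin_bernoulli hm hA (fun t _ => hB t) hc'
    have hz0 : c * ((Real.exp (A 0) : ℂ) * (1 - (B 0 : ℂ) * c ^ m) ^ (-(1 / m : ℂ))) = c := by
      simp [hA0, hB0]
    refine ⟨(hQ c).mpr ⟨_, hsol, hz0⟩, ?_⟩
    rw [hq c _ hsol hz0, bernoulliDisplacement, mul_sub, mul_one]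
  have hzero : ∀ c ∈ Q, (q c = 0 ↔
      c = 0 ∨ (B ω : ℂ) * c ^ m = 1 - Real.exp (m * A ω)) := by
    intro c hc
    refine ⟨fun h => ?_, fun h => ?_⟩
    · obtain ⟨z, hz, rfl⟩ := (hQ c).mp hc
      rw [hq _ z hz rfl, sub_eq_zero] at h
      have hfi := hz.bernoulli_first_integral hω.le hP1 hA (fun t _ => hB t) hA0 hB0
      rw [h, mul_comm] at hfi
      refine or_iff_not_imp_left.mpr fun h0 => ?_
      have := mul_right_cancel₀ (pow_ne_zero m h0) hfi
      rw [← this]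
      ring
    · rw [(hslit c (one_sub_mul_pow_mem_slitPlane hm h)).2, bernoulliDisplacement_eq_zero hm h]
  have hnear : ∀ c : ℂ, (c = 0 ∨ (B ω : ℂ) * c ^ m = 1 - Real.exp (m * A ω)) →
      q =ᶠ[nhds c] bernoulliDisplacement m (A ω) (B ω) := by
    intro c hc
    have hcont : Continuous fun c : ℂ => 1 - (B ω : ℂ) * c ^ m := by fun_prop
    filter_upwards [hcont.continuousAt.eventually_mem
      (Complex.isOpen_slitPlane.mem_nhds (one_sub_mul_pow_mem_slitPlane hm hc))] with w hw
    exact (hslit w hw).2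
  have hBC : (B ω : ℂ) ≠ 0 := by exact_mod_cast hBω.ne'
  rcases eq_or_ne (A ω) 0 with hAω | hAω
  · have hiff : ∀ c : ℂ, (c = 0 ∨ (B ω : ℂ) * c ^ m = 1 - Real.exp (m * A ω)) ↔ c = 0 := by
      simp [hAω, hBC, hm]
    refine ⟨{0}, fun _ => m + 1, ?_, fun c hc => ?_, ?_, by simp⟩
    · simpa using (hslit 0 (one_sub_mul_pow_mem_slitPlane (A := A ω) hm (.inl rfl))).1
    · rw [hzero c hc, hiff, Finset.mem_singleton]
    · simp only [Finset.mem_singleton, forall_eq]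
      refine ⟨by omega, HasZeroOfOrder.congr ?_ (hnear 0 (.inl rfl))⟩
      rw [hAω]
      exact hasZeroOfOrder_bernoulliDisplacement_of_eq_zero hm hBω.ne'
  · set a : ℂ := (1 - Real.exp (m * A ω)) / B ω with ha
    have hmem : ∀ c, c ∈ insert 0 (Polynomial.nthRootsFinset m a) ↔
        c = 0 ∨ (B ω : ℂ) * c ^ m = 1 - Real.exp (m * A ω) := by
      intro c
      rw [Finset.mem_insert, Polynomial.mem_nthRootsFinset (Nat.pos_of_ne_zero hm), ha,
        eq_div_iff hBC, mul_comm]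
    have ha0 : a ≠ 0 := by
      refine div_ne_zero (sub_ne_zero.mpr fun h => ?_) hBC
      have : Real.exp (m * A ω) = 1 := by exact_mod_cast h.symm
      rw [Real.exp_eq_one_iff] at this
      exact mul_ne_zero (Nat.cast_ne_zero.mpr hm) hAω this
    refine ⟨insert 0 (Polynomial.nthRootsFinset m a), fun _ => 1, fun c hc => ?_, fun c hc => ?_,
      fun c hc => ⟨le_rfl, ?_⟩, ?_⟩
    · exact (hslit c (one_sub_mul_pow_mem_slitPlane hm ((hmem c).mp hc))).1
    · rw [hzero c hc, hmem]
    · exact (hasZeroOfOrder_bernoulliDisplacement_one hm hAω hBω.ne' ((hmem c).mp hc)).congr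
        (hnear c ((hmem c).mp hc))
    · rw [← Finset.card_eq_sum_ones, card_insert_zero_nthRootsFinset hm ha0]
end
end

section
/- Let n ≥ 4 and suppose max_{0≤t≤ω} |P_0(t)| < 1. Suppose that for all t ∈ [0,ω]: |P_i(t)| ≤ (1 − |P_0(t)|)·sin(π/(n−2))/(n−3) for every index i with i ≠ 0, 1, n−1, and |P_1(t)| ≥ 1 + |P_0(t)| + |P_{n−1}(t)| + (1 − |P_0(t)|)·sin(π/(n−2)). Then equation (1.1) has no singular periodic solution; i.e., the tuple P = (P_0, …, P_{n−1}) belongs to the set 𝓐. -/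
open Set Real Filter

noncomputable section

/-- Right-hand side of equation (1.1). -/
def rhsC (n : ℕ) (P : Fin n → ℝ → ℝ) (t : ℝ) (z : ℂ) : ℂ :=
  z ^ n + ∑ i : Fin n, (P i t : ℂ) * z ^ (i : ℕ)

/-- `z` is a (complex-valued) solution of (1.1) on all of `[0, ω]`. -/
def IsSolC (n : ℕ) (ω : ℝ) (P : Fin n → ℝ → ℝ) (z : ℝ → ℂ) : Prop :=
  ∀ t ∈ Icc (0:ℝ) ω, HasDerivWithinAt z (rhsC n P t (z t)) (Icc (0:ℝ) ω) t

/-- `z` is a periodic solution of (1.1). -/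
def IsPeriodicC (n : ℕ) (ω : ℝ) (P : Fin n → ℝ → ℝ) (z : ℝ → ℂ) : Prop :=
  IsSolC n ω P z ∧ z ω = z 0

/-- `P` has a singular periodic solution: there are equations `P_j` (with continuous
coefficients) converging uniformly on `[0, ω]` to `P`, and zeros `c_j` of their
displacement functions, such that either `c_j → c` and the solution of `P` starting
at `c` fails to be defined on all of `[0, ω]`, or `c_j → ∞`. -/
def HasSingularPeriodicSol (n : ℕ) (ω : ℝ) (P : Fin n → ℝ → ℝ) : Prop :=
  ∃ (Pj : ℕ → Fin n → ℝ → ℝ) (cj : ℕ → ℂ),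
    (∀ j i, ContinuousOn (Pj j i) (Icc 0 ω)) ∧
    (∀ ε > (0:ℝ), ∀ᶠ j in atTop, ∀ i, ∀ t ∈ Icc (0:ℝ) ω, |Pj j i t - P i t| ≤ ε) ∧
    (∀ j, ∃ z : ℝ → ℂ, IsPeriodicC n ω (Pj j) z ∧ z 0 = cj j) ∧
    ((∃ c : ℂ, Tendsto cj atTop (nhds c) ∧ ¬ ∃ z : ℝ → ℂ, IsSolC n ω P z ∧ z 0 = c) ∨
      Tendsto (fun j => ‖cj j‖) atTop atTop)

theorem ne_zero_of_periodic_of_deriv_pos {ω : ℝ} (hω : 0 < ω) {g g' : ℝ → ℝ}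
    (hg : ∀ t ∈ Icc (0:ℝ) ω, HasDerivWithinAt g (g' t) (Icc (0:ℝ) ω) t) (hper : g ω = g 0)
    (h : ∀ t ∈ Icc (0:ℝ) ω, g t = 0 → 0 < g' t) : ∀ t ∈ Icc (0:ℝ) ω, g t ≠ 0 := by
  have hcont : ContinuousOn g (Icc 0 ω) := fun t ht => (hg t ht).continuousWithinAt
  have hright : ∀ t ∈ Ico (0:ℝ) ω, HasDerivWithinAt g (g' t) (Ici t) t := fun t ht =>
    (hg t (Ico_subset_Icc_self ht)).mono_of_mem_nhdsWithin
      (mem_of_superset (Icc_mem_nhdsGE ht.2) (Icc_subset_Icc_left ht.1))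
  have key : ∀ a ∈ Icc (0:ℝ) ω, 0 ≤ g a → ∀ t ∈ Icc a ω, 0 ≤ g t := by
    intro a ha hga
    refine image_le_of_deriv_right_lt_deriv_boundary' (f := fun _ => (0:ℝ)) (f' := fun _ => 0)
      continuousOn_const (fun x _ => hasDerivWithinAt_const _ _ _) hga
      (hcont.mono (Icc_subset_Icc_left ha.1)) (fun x hx => hright x ⟨ha.1.trans hx.1, hx.2⟩) ?_
    intro x hx hx0
    exact h x ⟨ha.1.trans hx.1, hx.2.le⟩ hx0.symm
  intro t ht h0
  have hω0 : (0:ℝ) ∈ Icc (0:ℝ) ω := ⟨le_rfl, hω.le⟩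
  have hωω : ω ∈ Icc (0:ℝ) ω := ⟨hω.le, le_rfl⟩
  have hnn : ∀ t ∈ Icc (0:ℝ) ω, 0 ≤ g t :=
    key 0 hω0 (hper ▸ key t ht h0.ge ω ⟨ht.2, le_rfl⟩)
  have hleft : ∀ t ∈ Icc (0:ℝ) ω, 0 < t → g t ≠ 0 := by
    intro t ht htpos h0
    have hd : HasDerivWithinAt g (g' t) (Icc 0 t) t := (hg t ht).mono (Icc_subset_Icc_right ht.2)
    refine (h t ht h0).not_ge (le_of_tendsto
      ((hasDerivWithinAt_iff_tendsto_slope' self_notMem_Iio).1 (hd.mono_of_mem_nhdsWithin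
        (Icc_mem_nhdsLT htpos))) ?_)
    filter_upwards [Icc_mem_nhdsLT htpos, self_mem_nhdsWithin] with x hx hxt
    rw [slope_def_field, h0, sub_zero]
    exact div_nonpos_of_nonneg_of_nonpos (hnn x ⟨hx.1, hx.2.trans ht.2⟩) (sub_nonpos.2 hx.2)
  rcases ht.1.eq_or_lt with rfl | htpos
  · exact hleft ω hωω hω (hper.trans h0)
  · exact hleft t ht htpos h0

/-- The radial component `Re (ż / z)` of the vector field in logarithmic polar coordinates
`z = exp (l + θ i)`. -/
def radialRate (n : ℕ) (p : ℕ → ℝ) (l θ : ℝ) : ℝ :=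
  exp (((n:ℝ) - 1) * l) * cos (((n:ℝ) - 1) * θ) +
    ∑ i ∈ Finset.range n, p i * (exp (((i:ℝ) - 1) * l) * cos (((i:ℝ) - 1) * θ))

/-- The angular component `Im (ż / z)` of the vector field in logarithmic polar coordinates. -/
def angularRate (n : ℕ) (p : ℕ → ℝ) (l θ : ℝ) : ℝ :=
  exp (((n:ℝ) - 1) * l) * sin (((n:ℝ) - 1) * θ) +
    ∑ i ∈ Finset.range n, p i * (exp (((i:ℝ) - 1) * l) * sin (((i:ℝ) - 1) * θ))

/-- Coefficients satisfying the hypotheses of the theorem up to an error `δ`. -/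
structure NearCoeffs (n : ℕ) (s μ δ M σ : ℝ) (p : ℕ → ℝ) : Prop where
  zero : |p 0| ≤ 1 - μ
  mid : ∀ i, 2 ≤ i → i + 2 ≤ n → |p i| ≤ (1 - |p 0|) * s / ((n:ℝ) - 3) + δ
  one : 1 + |p 0| + |p (n - 1)| + (1 - |p 0|) * s - δ ≤ σ * p 1
  bdd : ∀ i, |p i| ≤ M

theorem abs_sin_nat_mul_le (k : ℕ) (θ : ℝ) : |sin (k * θ)| ≤ k * |sin θ| := by
  induction k with
  | zero => simp
  | succ k ih =>
    have : ((k + 1 : ℕ) : ℝ) * θ = k * θ + θ := by push_cast; ring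
    rw [this, sin_add]
    have h1 := abs_cos_le_one (k * θ)
    have h2 := abs_cos_le_one θ
    calc |sin (k * θ) * cos θ + cos (k * θ) * sin θ|
        ≤ |sin (k * θ)| * |cos θ| + |cos (k * θ)| * |sin θ| := by
          rw [← abs_mul, ← abs_mul]; exact abs_add_le _ _
      _ ≤ |sin (k * θ)| * 1 + 1 * |sin θ| := by gcongr
      _ ≤ ((k + 1 : ℕ) : ℝ) * |sin θ| := by push_cast; linarith

theorem abs_sin_sub_one_mul_le {n i : ℕ} (hi : i ≤ n) (hn : 1 ≤ n) (θ : ℝ) :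
    |sin (((i:ℝ) - 1) * θ)| ≤ n * |sin θ| := by
  have hn' : (1:ℝ) ≤ n := by exact_mod_cast hn
  cases i with
  | zero =>
    have : (((0:ℕ):ℝ) - 1) * θ = -θ := by push_cast; ring
    rw [this, sin_neg, abs_neg]
    nlinarith [abs_nonneg (sin θ)]
  | succ k =>
    have : (((k + 1 : ℕ):ℝ) - 1) * θ = k * θ := by push_cast; ring
    rw [this]
    refine (abs_sin_nat_mul_le k θ).trans ?_
    have : (k:ℝ) ≤ n := by exact_mod_cast (Nat.le_of_succ_le hi)
    gcongr

theorem sum_range_add_four {m : ℕ} (f : ℕ → ℝ) :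
    ∑ i ∈ Finset.range (m + 4), f i =
      f 0 + f 1 + (f 2 + ∑ i ∈ Finset.range m, f (i + 3)) + f (m + 3) := by
  rw [Finset.sum_range_succ, Finset.sum_range_succ', Finset.sum_range_succ',
    Finset.sum_range_succ']
  ring

/-- Lower bound for the radial rate on a curve close to the unit circle. -/
theorem le_radialRate {n : ℕ} (hn : 4 ≤ n) {s μ δ M σ : ℝ} {p : ℕ → ℝ}
    (hp : NearCoeffs n s μ δ M σ p) (hσ : |σ| = 1) (hs : 0 < s) (hs1 : s ≤ 1) (hμ : 0 < μ)
    (hδ : 0 ≤ δ) {l θ X Y : ℝ} (hX0 : 0 ≤ X) (hX2 : X ≤ 2)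
    (hX : ∀ i : ℕ, 1 ≤ i → i < n → exp (((i:ℝ) - 1) * l) ≤ 1 + X)
    (hY : exp (((n:ℝ) - 1) * l) + |p 0| * exp (-l) ≤ 1 + |p 0| + Y) :
    μ * s / n * (exp l * (1 - |cos θ|)) - Y - (M + 1) * X - 4 * n * δ
      ≤ σ * radialRate n p l θ := by
  obtain ⟨m, rfl⟩ := Nat.exists_eq_add_of_le' hn
  set b : ℝ := (1 - |p 0|) * s / (((m + 4 : ℕ):ℝ) - 3) with hb
  have hm : (0:ℝ) ≤ m := Nat.cast_nonneg m
  have hm1 : (((m + 4 : ℕ):ℝ) - 3) = m + 1 := by push_cast; ring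
  have hz := hp.zero
  have hbm : (m + 1) * b = (1 - |p 0|) * s := by rw [hb, hm1]; field_simp
  have hb0 : 0 ≤ b := by
    rw [hb, hm1]; exact div_nonneg (mul_nonneg (by linarith) hs.le) (by linarith)
  have hbl : μ * s / ((m + 4 : ℕ):ℝ) ≤ b := by
    rw [hb, hm1]
    refine div_le_div₀ (mul_nonneg (by linarith) hs.le)
      (mul_le_mul_of_nonneg_right (by linarith) hs.le) (by linarith) (by push_cast; linarith)
  have low : ∀ (a e c : ℝ), 0 ≤ e → |c| ≤ 1 → -(|a| * e) ≤ σ * (a * (e * c)) := by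
    intro a e c he hc
    have h1 : |σ * (a * (e * c))| ≤ |a| * e := by
      rw [abs_mul, hσ, one_mul, abs_mul, abs_mul, abs_of_nonneg he]
      nlinarith [mul_nonneg (abs_nonneg a) he]
    exact (abs_le.1 h1).1
  have htop : -exp ((((m + 4 : ℕ):ℝ) - 1) * l) ≤
      σ * (exp ((((m + 4 : ℕ):ℝ) - 1) * l) * cos ((((m + 4 : ℕ):ℝ) - 1) * θ)) := by
    have := low 1 (exp ((((m + 4 : ℕ):ℝ) - 1) * l)) _ (exp_pos _).le
      (abs_cos_le_one ((((m + 4 : ℕ):ℝ) - 1) * θ))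
    simpa using this
  have hzero : -(|p 0| * exp (-l)) ≤
      σ * (p 0 * (exp ((((0:ℕ):ℝ) - 1) * l) * cos ((((0:ℕ):ℝ) - 1) * θ))) := by
    have := low (p 0) (exp (-l)) _ (exp_pos _).le (abs_cos_le_one ((((0:ℕ):ℝ) - 1) * θ))
    simpa using this
  have hone : σ * (p 1 * (exp ((((1:ℕ):ℝ) - 1) * l) * cos ((((1:ℕ):ℝ) - 1) * θ))) = σ * p 1 := by
    simp
  have htwo : -((b + δ) * (1 + X)) + b * (exp l * (1 - |cos θ|)) ≤
      σ * (p 2 * (exp ((((2:ℕ):ℝ) - 1) * l) * cos ((((2:ℕ):ℝ) - 1) * θ))) := by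
    have e : ((2:ℕ):ℝ) - 1 = 1 := by norm_num
    have h2 := hX 2 (by norm_num) (by omega)
    have h3 := hp.mid 2 le_rfl (by omega)
    rw [e, one_mul] at *
    rw [one_mul]
    have h1 : |σ * (p 2 * (exp l * cos θ))| = |p 2| * (exp l * |cos θ|) := by
      rw [abs_mul, hσ, one_mul, abs_mul, abs_mul, abs_of_pos (exp_pos l)]
    have h4 := (abs_le.1 h1.le).1
    have h5 : |p 2| * (exp l * |cos θ|) ≤ (b + δ) * (exp l * |cos θ|) := by gcongr
    have h6 : 0 ≤ δ * (exp l * (1 - |cos θ|)) :=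
      mul_nonneg hδ (mul_nonneg (exp_pos l).le (by linarith [abs_cos_le_one θ]))
    have h7 : (b + δ) * exp l ≤ (b + δ) * (1 + X) := by gcongr
    nlinarith
  have hmid : -(m * ((b + δ) * (1 + X))) ≤ σ * ∑ i ∈ Finset.range m,
      p (i + 3) * (exp ((((i + 3 : ℕ):ℝ) - 1) * l) * cos ((((i + 3 : ℕ):ℝ) - 1) * θ)) := by
    rw [Finset.mul_sum]
    have : -(m * ((b + δ) * (1 + X))) = ∑ i ∈ Finset.range m, -((b + δ) * (1 + X)) := by simp
    rw [this]
    refine Finset.sum_le_sum fun i hi => ?_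
    have hi := Finset.mem_range.1 hi
    refine le_trans ?_ (low _ _ _ (exp_pos _).le (abs_cos_le_one _))
    have h3 := hp.mid (i + 3) (by omega) (by omega)
    have h2 := hX (i + 3) (by omega) (by omega)
    have : |p (i + 3)| * exp ((((i + 3 : ℕ):ℝ) - 1) * l) ≤ (b + δ) * (1 + X) := by gcongr
    linarith
  have hlast : -(|p (m + 3)| * (1 + X)) ≤
      σ * (p (m + 3) * (exp ((((m + 3 : ℕ):ℝ) - 1) * l) * cos ((((m + 3 : ℕ):ℝ) - 1) * θ))) := by
    refine le_trans ?_ (low _ _ _ (exp_pos _).le (abs_cos_le_one _))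
    have := mul_le_mul_of_nonneg_left (hX (m + 3) (by omega) (by omega)) (abs_nonneg (p (m + 3)))
    linarith
  have h1 := hp.one
  rw [show m + 4 - 1 = m + 3 by omega] at h1
  have hM : |p (m + 3)| * X ≤ M * X := by gcongr; exact hp.bdd _
  have hS : (1 - |p 0|) * s * X ≤ X := by
    have : (1 - |p 0|) * s ≤ 1 := by nlinarith [abs_nonneg (p 0)]
    nlinarith
  have hg : μ * s / ((m + 4 : ℕ):ℝ) * (exp l * (1 - |cos θ|)) ≤ b * (exp l * (1 - |cos θ|)) :=
    mul_le_mul_of_nonneg_right hbl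
      (mul_nonneg (exp_pos l).le (by linarith [abs_cos_le_one θ]))
  have hδX : (m + 1) * (δ * X) ≤ (m + 1) * (δ * 2) := by gcongr
  have hmδ : 0 ≤ m * δ := mul_nonneg hm hδ
  rw [radialRate, sum_range_add_four]
  simp only [mul_add σ]
  rw [hone]
  have e1 : (m + 1) * b * (1 + X) = (1 - |p 0|) * s * (1 + X) := by rw [hbm]
  have e2 : 4 * ((m + 4 : ℕ):ℝ) * δ = 4 * (m * δ) + 16 * δ := by push_cast; ring
  rw [e2]
  refine le_trans ?_ (add_le_add htop (add_le_add (add_le_add (add_le_add hzero le_rfl)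
    (add_le_add htwo hmid)) hlast))
  linarith

theorem exp_le_one_add_two_mul {x : ℝ} (h0 : 0 ≤ x) (h1 : x ≤ 1) : exp x ≤ 1 + 2 * x := by
  have := (abs_le.1 (abs_exp_sub_one_sub_id_le (abs_le.2 ⟨by linarith, h1⟩))).2
  nlinarith

theorem abs_angularRate_le {n : ℕ} (hn : 1 ≤ n) {M : ℝ} {p : ℕ → ℝ} (hp : ∀ i, |p i| ≤ M)
    {l : ℝ} (hl : n * |l| ≤ 1) (θ : ℝ) :
    |angularRate n p l θ| ≤ 3 * n * (1 + n * M) * |sin θ| := by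
  have hn' : (1:ℝ) ≤ n := by exact_mod_cast hn
  have hM : 0 ≤ M := (abs_nonneg _).trans (hp 0)
  have hterm : ∀ i : ℕ, i ≤ n →
      |exp (((i:ℝ) - 1) * l) * sin (((i:ℝ) - 1) * θ)| ≤ 3 * n * |sin θ| := by
    intro i hi
    have hi' : (i:ℝ) ≤ n := by exact_mod_cast hi
    have hi0 : (0:ℝ) ≤ i := Nat.cast_nonneg i
    have hexp : exp (((i:ℝ) - 1) * l) ≤ 3 := by
      have : |((i:ℝ) - 1) * l| ≤ 1 := by
        rw [abs_mul]
        refine le_trans ?_ hl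
        gcongr
        exact abs_le.2 ⟨by linarith, by linarith⟩
      have h1 := (abs_le.1 this).2
      have h2 := (abs_le.1 (abs_exp_sub_one_sub_id_le this)).2
      nlinarith [abs_nonneg (((i:ℝ) - 1) * l), (abs_le.1 this).1]
    rw [abs_mul, abs_of_pos (exp_pos _), mul_assoc]
    exact mul_le_mul hexp (abs_sin_sub_one_mul_le hi hn θ) (abs_nonneg _) (by norm_num)
  calc |angularRate n p l θ|
      ≤ 3 * n * |sin θ| + ∑ i ∈ Finset.range n, M * (3 * n * |sin θ|) := by
        refine (abs_add_le _ _).trans (add_le_add (hterm n le_rfl)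
          ((Finset.abs_sum_le_sum_abs _ _).trans (Finset.sum_le_sum fun i hi => ?_)))
        rw [abs_mul]
        exact mul_le_mul (hp i) (hterm i (Finset.mem_range.1 hi).le) (abs_nonneg _) hM
    _ = 3 * n * (1 + n * M) * |sin θ| := by
        rw [Finset.sum_const, Finset.card_range, nsmul_eq_mul]; ring

/-- Solutions cross the curve `l = ε (K sin² θ - 1)` in one direction only. -/
theorem barrier_pos {n : ℕ} (hn : 4 ≤ n) {s μ δ M σ : ℝ} {p : ℕ → ℝ}
    (hp : NearCoeffs n s μ δ M σ p) (hσ : |σ| = 1) (hs : 0 < s) (hs1 : s ≤ 1) (hμ : 0 < μ)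
    (hδ : 0 ≤ δ) {ε K l θ : ℝ} (hε : 0 < ε) (hK : 1 ≤ K) (hnK : n * (K * ε) ≤ 1)
    (hKμ : 4 * (K * ε) ≤ μ)
    (h1 : 8 * (K * ε) * (3 * n * (1 + n * M)) ≤ μ * s / n / 6)
    (h2 : 4 * (K * ε) * (2 * n * (M + 2)) ≤ μ * s / n / 6)
    (h3 : 2 * μ * (K * ε) ≤ μ * s / n / 6) (h4 : 8 * n * δ < μ * ε)
    (hl : l = ε * (K * sin θ ^ 2 - 1)) :
    0 < σ * (radialRate n p l θ - ε * (K * (2 * sin θ * cos θ)) * angularRate n p l θ) := by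
  have hn' : (4:ℝ) ≤ n := by exact_mod_cast hn
  set c := μ * s / n / 6 with hc
  have hM : 0 ≤ M := (abs_nonneg _).trans (hp.bdd 0)
  have hp0 := hp.zero
  have hp00 := abs_nonneg (p 0)
  have hμ1 : μ ≤ 1 := by linarith
  have hc0 : 0 < c := by positivity
  have hq0 : 0 ≤ sin θ ^ 2 := sq_nonneg _
  have hq1 : sin θ ^ 2 ≤ 1 := sin_sq_le_one θ
  set q := sin θ ^ 2 with hq
  have hKε : 0 < K * ε := by positivity
  have hεK : ε ≤ K * ε := by nlinarith
  have hl1 : -ε ≤ l := by rw [hl]; nlinarith [mul_nonneg hKε.le hq0]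
  have hlq : l ≤ K * ε * q := by rw [hl]; nlinarith
  have hl2 : l ≤ K * ε := by nlinarith
  have hlabs : |l| ≤ K * ε := abs_le.2 ⟨by linarith, hl2⟩
  have hnl : n * |l| ≤ 1 := (mul_le_mul_of_nonneg_left hlabs (by linarith)).trans hnK
  have hB : |ε * (K * (2 * sin θ * cos θ)) * angularRate n p l θ| ≤ c / 4 * q := by
    have e : |ε * (K * (2 * sin θ * cos θ)) * angularRate n p l θ| =
        2 * (K * ε) * (|cos θ| * (|sin θ| * |angularRate n p l θ|)) := by
      simp only [abs_mul, abs_two, abs_of_pos hε, abs_of_pos (by linarith : 0 < K)]; ring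
    have hq' : q = |sin θ| * |sin θ| := by rw [hq, ← sq, sq_abs]
    have h5 : |cos θ| * (|sin θ| * |angularRate n p l θ|) ≤
        1 * (|sin θ| * (3 * n * (1 + n * M) * |sin θ|)) := by
      gcongr
      · exact abs_cos_le_one θ
      · exact abs_angularRate_le (by omega) hp.bdd hnl θ
    rw [e]
    calc _ ≤ 2 * (K * ε) * (1 * (|sin θ| * (3 * n * (1 + n * M) * |sin θ|))) := by gcongr
      _ = 8 * (K * ε) * (3 * n * (1 + n * M)) / 4 * q := by rw [hq']; ring
      _ ≤ c / 4 * q := by gcongr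
  have hgain : c * q ≤ μ * s / n * (exp l * (1 - |cos θ|)) := by
    have he : 1 / 3 ≤ exp l := by linarith [add_one_le_exp l]
    have hcos : q / 2 ≤ 1 - |cos θ| := by
      have : q = 1 - |cos θ| ^ 2 := by rw [hq, sq_abs, sin_sq]
      nlinarith [abs_nonneg (cos θ), abs_cos_le_one θ]
    calc c * q = μ * s / n * (1 / 3 * (q / 2)) := by rw [hc]; ring
      _ ≤ _ := by gcongr
  have hred : ∀ X Y : ℝ, 0 ≤ X → X ≤ 2 →
      (∀ i : ℕ, 1 ≤ i → i < n → exp (((i:ℝ) - 1) * l) ≤ 1 + X) →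
      exp (((n:ℝ) - 1) * l) + |p 0| * exp (-l) ≤ 1 + |p 0| + Y →
      0 < c * q * (3 / 4) - Y - (M + 1) * X - 4 * n * δ →
      0 < σ * (radialRate n p l θ - ε * (K * (2 * sin θ * cos θ)) * angularRate n p l θ) := by
    intro X Y hX0 hX2 hX hY hpos
    have h5 := le_radialRate hn hp hσ hs hs1 hμ hδ (θ := θ) hX0 hX2 hX hY
    have h6 : σ * (ε * (K * (2 * sin θ * cos θ)) * angularRate n p l θ) ≤ c / 4 * q := by
      refine (le_abs_self _).trans ?_
      rwa [abs_mul, hσ, one_mul]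
    rw [mul_sub]
    linarith
  rcases le_or_gt l 0 with hl0 | hl0
  · have hexp : ∀ x : ℝ, |x| ≤ 1 → exp x ≤ 1 + x + x ^ 2 := fun x hx => by
      linarith [(abs_le.1 (abs_exp_sub_one_sub_id_le hx)).2]
    have hl1' : |l| ≤ 1 := by linarith
    refine hred 0 (μ * l / 2) le_rfl (by norm_num) ?_ ?_ ?_
    · intro i hi _
      have : (1:ℝ) ≤ i := by exact_mod_cast hi
      rw [add_zero, exp_le_one_iff]
      exact mul_nonpos_of_nonneg_of_nonpos (by linarith) hl0
    · have h5 : exp (((n:ℝ) - 1) * l) ≤ 1 + l + l ^ 2 :=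
        (exp_le_exp.2 (by nlinarith)).trans (hexp l hl1')
      have h6 : |p 0| * exp (-l) ≤ |p 0| * (1 + -l + (-l) ^ 2) := by
        gcongr; exact hexp _ (by rwa [abs_neg])
      have h7 : -l ≤ μ / 4 := by linarith
      have h8 : |p 0| * l ^ 2 ≤ 1 * l ^ 2 := by gcongr; linarith
      have h9 : l * (1 - |p 0|) ≤ l * μ := mul_le_mul_of_nonpos_left (by linarith) hl0
      have h10 : -l * -l ≤ -l * (μ / 4) := mul_le_mul_of_nonneg_left h7 (by linarith)
      linarith
    · have h5 : 2 * μ * (K * ε) * q ≤ c * q := by gcongr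
      have : μ * l / 2 = μ * (K * ε) * q / 2 - μ * ε / 2 := by rw [hl]; ring
      rw [this]
      linarith [mul_nonneg hc0.le hq0]
  · have habs : |l| = l := abs_of_pos hl0
    rw [habs] at hnl
    refine hred (2 * (n * l)) (2 * (n * l)) (by positivity) (by linarith) ?_ ?_ ?_
    · intro i hi hin
      have h5 : (1:ℝ) ≤ i := by exact_mod_cast hi
      have h6 : (i:ℝ) ≤ n := by exact_mod_cast hin.le
      refine (exp_le_exp.2 ?_).trans (exp_le_one_add_two_mul (by positivity) hnl)
      gcongr
      linarith
    · have h5 : exp (((n:ℝ) - 1) * l) ≤ 1 + 2 * (n * l) := by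
        refine (exp_le_exp.2 ?_).trans (exp_le_one_add_two_mul (by positivity) hnl)
        gcongr
        linarith
      have h6 : |p 0| * exp (-l) ≤ |p 0| * 1 := by
        gcongr; exact exp_le_one_iff.2 (by linarith)
      linarith
    · have h5 : l * (2 * n * (M + 2)) ≤ K * ε * q * (2 * n * (M + 2)) := by gcongr
      have h6 : 4 * (K * ε) * (2 * n * (M + 2)) * q ≤ c * q := by gcongr
      have hKq : 1 ≤ K * q := by
        by_contra hlt
        have : l ≤ 0 := by rw [hl]; exact mul_nonpos_of_nonneg_of_nonpos hε.le (by linarith)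
        linarith
      have h7 : 2 * μ * (K * ε) * q ≤ c * q := by gcongr
      have h8 : μ * ε * 1 ≤ μ * ε * (K * q) := by gcongr
      linarith [mul_nonneg hc0.le hq0]

/-- Solutions cross the ray at angle `j π / (n - 2)`, outside the unit disc, in one direction
only. -/
theorem ray_pos {n : ℕ} (hn : 4 ≤ n) {s μ δ M σ : ℝ} {p : ℕ → ℝ}
    (hp : NearCoeffs n s μ δ M σ p) (hs : 0 < s) (hμ : 0 < μ)
    {ε l θ : ℝ} {j : ℕ} (hl : ε ≤ l) (hε : 0 < ε) (hθ : ((n:ℝ) - 2) * θ = j * π)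
    (hsθ : s ≤ sin θ) (hδ : 0 ≤ δ) (hδε : n * δ < 2 * s * ε) :
    0 < (-1) ^ j * angularRate n p l θ := by
  obtain ⟨m, rfl⟩ := Nat.exists_eq_add_of_le' hn
  set b : ℝ := (1 - |p 0|) * s / (((m + 4 : ℕ):ℝ) - 3) with hb
  have hm : (0:ℝ) ≤ m := Nat.cast_nonneg m
  have hm1 : (((m + 4 : ℕ):ℝ) - 3) = m + 1 := by push_cast; ring
  have hz := hp.zero
  have hl0 : 0 < l := hε.trans_le hl
  have hbm : (m + 1) * b = (1 - |p 0|) * s := by rw [hb, hm1]; field_simp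
  have hb0 : 0 ≤ b := by
    rw [hb, hm1]; exact div_nonneg (mul_nonneg (by linarith) hs.le) (by linarith)
  set W := exp ((m + 1) * l) with hW
  have hW0 : 0 < W := exp_pos _
  have hτ : |(-1 : ℝ) ^ j| = 1 := by simp
  have low : ∀ (a e c : ℝ), 0 ≤ e → |c| ≤ 1 → -(|a| * e) ≤ (-1) ^ j * (a * (e * c)) := by
    intro a e c he hc
    have h1 : |(-1) ^ j * (a * (e * c))| ≤ |a| * e := by
      rw [abs_mul, hτ, one_mul, abs_mul, abs_mul, abs_of_nonneg he]
      nlinarith [mul_nonneg (abs_nonneg a) he]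
    exact (abs_le.1 h1).1
  have htop : sin θ * (W * (1 + 2 * ε)) ≤
      (-1) ^ j * (exp ((((m + 4 : ℕ):ℝ) - 1) * l) * sin ((((m + 4 : ℕ):ℝ) - 1) * θ)) := by
    have e1 : (((m + 4 : ℕ):ℝ) - 1) * θ = θ + j * π := by rw [← hθ]; ring
    have e2 : exp ((((m + 4 : ℕ):ℝ) - 1) * l) = W * exp (2 * l) := by
      rw [hW, ← exp_add]; congr 1; push_cast; ring
    have e3 : ((-1 : ℝ) ^ j) * (-1) ^ j = 1 := by rw [← mul_pow]; simp
    rw [e1, sin_add_nat_mul_pi, e2,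
      show (-1 : ℝ) ^ j * (W * exp (2 * l) * ((-1) ^ j * sin θ)) =
        ((-1 : ℝ) ^ j * (-1) ^ j) * (sin θ * (W * exp (2 * l))) by ring, e3, one_mul]
    have : 1 + 2 * ε ≤ exp (2 * l) := by linarith [add_one_le_exp (2 * l)]
    have : 0 ≤ sin θ := hs.le.trans hsθ
    gcongr
  have hzero : -(|p 0| * (sin θ * W)) ≤
      (-1) ^ j * (p 0 * (exp ((((0:ℕ):ℝ) - 1) * l) * sin ((((0:ℕ):ℝ) - 1) * θ))) := by
    have h1 : 0 ≤ sin θ := hs.le.trans hsθ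
    have h2 := low (p 0) (sin θ * exp (-l)) (-1) (mul_nonneg h1 (exp_pos _).le) (by simp)
    have h3 : exp (-l) ≤ W := exp_le_exp.2 (by nlinarith)
    have h4 : |p 0| * (sin θ * exp (-l)) ≤ |p 0| * (sin θ * W) := by gcongr
    have e : p 0 * (exp ((((0:ℕ):ℝ) - 1) * l) * sin ((((0:ℕ):ℝ) - 1) * θ)) =
        p 0 * (sin θ * exp (-l) * -1) := by
      have : ∀ x : ℝ, (((0:ℕ):ℝ) - 1) * x = -x := fun x => by push_cast; ring
      rw [this, this, sin_neg]; ring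
    rw [e]
    linarith
  have hone : (-1) ^ j * (p 1 * (exp ((((1:ℕ):ℝ) - 1) * l) * sin ((((1:ℕ):ℝ) - 1) * θ))) = 0 := by
    simp
  have hmidterm : ∀ i : ℕ, 2 ≤ i → i + 2 ≤ m + 4 → -((b + δ) * W) ≤
      (-1) ^ j * (p i * (exp (((i:ℝ) - 1) * l) * sin (((i:ℝ) - 1) * θ))) := by
    intro i hi hi2
    refine le_trans ?_ (low _ _ _ (exp_pos _).le (abs_sin_le_one _))
    have h3 := hp.mid i hi hi2
    have h2 : exp (((i:ℝ) - 1) * l) ≤ W := by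
      refine exp_le_exp.2 (mul_le_mul_of_nonneg_right ?_ hl0.le)
      have : (i:ℝ) ≤ m + 2 := by exact_mod_cast (by omega : i ≤ m + 2)
      linarith
    have : |p i| * exp (((i:ℝ) - 1) * l) ≤ (b + δ) * W := by gcongr
    linarith
  have hmid : -(m * ((b + δ) * W)) ≤ (-1) ^ j * ∑ i ∈ Finset.range m,
      p (i + 3) * (exp ((((i + 3 : ℕ):ℝ) - 1) * l) * sin ((((i + 3 : ℕ):ℝ) - 1) * θ)) := by
    rw [Finset.mul_sum]
    have : -(m * ((b + δ) * W)) = ∑ i ∈ Finset.range m, -((b + δ) * W) := by simp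
    rw [this]
    refine Finset.sum_le_sum fun i hi => ?_
    have hi := Finset.mem_range.1 hi
    exact hmidterm (i + 3) (by omega) (by omega)
  have hlast : (-1) ^ j *
      (p (m + 3) * (exp ((((m + 3 : ℕ):ℝ) - 1) * l) * sin ((((m + 3 : ℕ):ℝ) - 1) * θ))) = 0 := by
    have : (((m + 3 : ℕ):ℝ) - 1) * θ = j * π := by rw [← hθ]; push_cast; ring
    rw [this, sin_nat_mul_pi]; ring
  rw [angularRate, sum_range_add_four]
  simp only [mul_add ((-1 : ℝ) ^ j)]
  rw [hone, hlast]
  refine lt_of_lt_of_le ?_ (add_le_add htop (add_le_add (add_le_add (add_le_add hzero le_rfl)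
    (add_le_add (hmidterm 2 le_rfl (by omega)) hmid)) le_rfl))
  have e1 : (m + 1) * b * W = (1 - |p 0|) * s * W := by rw [hbm]
  have h5 : 0 < 2 * s * ε - (m + 1) * δ := by push_cast at hδε; nlinarith
  have h6 : s * (1 + 2 * ε - |p 0|) ≤ sin θ * (1 + 2 * ε - |p 0|) := by
    gcongr; linarith
  have h7 := mul_le_mul_of_nonneg_right h6 hW0.le
  have h8 := mul_pos h5 hW0
  linarith

/-- In the sector `k π ≤ (n - 2) θ ≤ (k + 1) π`, the half-angle of `z ^ (n - 1)` relative to `k π`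
stays away from multiples of `π`, except near the real axis. -/
theorem sin_half_le_sin_of_sector {a k θ χ : ℝ} (hθ : θ ∈ Ioo 0 π) (h1 : k * π ≤ (a - 2) * θ)
    (h2 : (a - 2) * θ ≤ (k + 1) * π) (hχ : 2 * χ = (a - 1) * θ - k * π) :
    sin θ / 2 ≤ sin χ := by
  obtain ⟨x, hx0, hxπ, rfl⟩ : ∃ x, 0 ≤ x ∧ x ≤ π / 2 ∧ χ = θ / 2 + x :=
    ⟨χ - θ / 2, by linarith, by linarith, by ring⟩
  have hc : 0 < cos (θ / 2) := cos_pos_of_mem_Ioo ⟨by linarith [hθ.1, hθ.2], by linarith [hθ.2]⟩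
  have hs : 0 < sin (θ / 2) :=
    sin_pos_of_pos_of_lt_pi (by linarith [hθ.1]) (by linarith [hθ.1, hθ.2])
  have hcx : 0 ≤ cos x := cos_nonneg_of_mem_Icc ⟨by linarith [hθ.1, hθ.2], hxπ⟩
  have hsx : 0 ≤ sin x := sin_nonneg_of_nonneg_of_le_pi hx0 (by linarith [hθ.1, hθ.2])
  have e : sin θ = 2 * sin (θ / 2) * cos (θ / 2) := by rw [← sin_two_mul]; congr 1; ring
  have hsum : 1 ≤ cos x + sin x := by
    nlinarith [sin_sq_add_cos_sq x, mul_nonneg hcx hsx, add_nonneg hcx hsx]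
  rw [sin_add, e]
  nlinarith [cos_le_one (θ / 2), sin_le_one (θ / 2), mul_nonneg hs.le hc.le,
    mul_nonneg (mul_nonneg hs.le hcx) (sub_nonneg.2 (cos_le_one (θ/2))),
    mul_nonneg (mul_nonneg hs.le hc.le) (sub_nonneg.2 hsum),
    mul_nonneg (mul_nonneg hc.le hsx) (sub_nonneg.2 (sin_le_one (θ/2)))]

theorem le_sectorRate {n : ℕ} (hn : 1 ≤ n) {M : ℝ} {p : ℕ → ℝ} (hp : ∀ i, |p i| ≤ M)
    {l θ χ : ℝ} {k : ℕ} (hχ : 2 * χ = ((n:ℝ) - 1) * θ - k * π) (hθ : 0 < sin θ)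
    (hs : sin θ / 2 ≤ sin χ) :
    exp (((n:ℝ) - 1) * l) - M * (1 + 2 * n) * ∑ i ∈ Finset.range n, exp (((i:ℝ) - 1) * l) ≤
      (-1) ^ k * (-radialRate n p l θ + cos χ / sin χ * angularRate n p l θ) := by
  have hsχ : 0 < sin χ := by linarith
  have hM : 0 ≤ M := (abs_nonneg _).trans (hp 0)
  have hτ : |(-1 : ℝ) ^ k| = 1 := by simp
  have hψ : ((n:ℝ) - 1) * θ = 2 * χ + k * π := by rw [hχ]; ring
  have htop : (-1 : ℝ) ^ k * (-(exp (((n:ℝ) - 1) * l) * cos (((n:ℝ) - 1) * θ)) +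
      cos χ / sin χ * (exp (((n:ℝ) - 1) * l) * sin (((n:ℝ) - 1) * θ))) =
      exp (((n:ℝ) - 1) * l) := by
    have e3 : ((-1 : ℝ) ^ k) * (-1) ^ k = 1 := by rw [← mul_pow]; simp
    rw [hψ, cos_add_nat_mul_pi, sin_add_nat_mul_pi, sin_two_mul, cos_two_mul]
    calc _ = ((-1 : ℝ) ^ k * (-1) ^ k) * (exp (2 * 0 + ((n:ℝ) - 1) * l) *
          (-(2 * cos χ ^ 2 - 1) + 2 * cos χ ^ 2 * (sin χ / sin χ))) := by
          rw [mul_zero, zero_add]; ring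
      _ = _ := by rw [e3, div_self hsχ.ne']; ring_nf
  have hterm : ∀ i ∈ Finset.range n, -(M * (1 + 2 * n) * exp (((i:ℝ) - 1) * l)) ≤
      (-1) ^ k * (p i * (exp (((i:ℝ) - 1) * l) *
        (-cos (((i:ℝ) - 1) * θ) + cos χ / sin χ * sin (((i:ℝ) - 1) * θ)))) := by
    intro i hi
    have hcot : |cos χ / sin χ * sin (((i:ℝ) - 1) * θ)| ≤ 2 * n := by
      have h5 := abs_sin_sub_one_mul_le (Finset.mem_range.1 hi).le hn θ
      rw [abs_of_pos hθ] at h5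
      rw [div_mul_eq_mul_div, abs_div, abs_of_pos hsχ, div_le_iff₀ hsχ, abs_mul]
      calc |cos χ| * |sin (((i:ℝ) - 1) * θ)| ≤ 1 * (n * sin θ) := by
            gcongr; exact abs_cos_le_one χ
        _ ≤ 2 * n * sin χ := by nlinarith [(Nat.cast_nonneg n : (0:ℝ) ≤ n)]
    have hsum : |-cos (((i:ℝ) - 1) * θ) + cos χ / sin χ * sin (((i:ℝ) - 1) * θ)| ≤ 1 + 2 * n := by
      refine (abs_add_le _ _).trans (add_le_add ?_ hcot)
      rw [abs_neg]; exact abs_cos_le_one _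
    refine (abs_le.1 ?_).1
    rw [abs_mul, hτ, one_mul, abs_mul, abs_mul, abs_of_pos (exp_pos _)]
    calc _ ≤ M * (exp (((i:ℝ) - 1) * l) * (1 + 2 * n)) := by gcongr; exact hp i
      _ = _ := by ring
  have hsum := Finset.sum_le_sum hterm
  rw [← Finset.mul_sum, Finset.sum_neg_distrib, ← Finset.mul_sum] at hsum
  have e : (-1 : ℝ) ^ k * (-radialRate n p l θ + cos χ / sin χ * angularRate n p l θ) =
      (-1 : ℝ) ^ k * (-(exp (((n:ℝ) - 1) * l) * cos (((n:ℝ) - 1) * θ)) +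
      cos χ / sin χ * (exp (((n:ℝ) - 1) * l) * sin (((n:ℝ) - 1) * θ))) +
      (-1) ^ k * ∑ i ∈ Finset.range n, (p i * (exp (((i:ℝ) - 1) * l) *
        (-cos (((i:ℝ) - 1) * θ) + cos χ / sin χ * sin (((i:ℝ) - 1) * θ)))) := by
    have : ∑ i ∈ Finset.range n, (p i * (exp (((i:ℝ) - 1) * l) *
        (-cos (((i:ℝ) - 1) * θ) + cos χ / sin χ * sin (((i:ℝ) - 1) * θ)))) =
        -∑ i ∈ Finset.range n, p i * (exp (((i:ℝ) - 1) * l) * cos (((i:ℝ) - 1) * θ)) +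
        cos χ / sin χ *
          ∑ i ∈ Finset.range n, p i * (exp (((i:ℝ) - 1) * l) * sin (((i:ℝ) - 1) * θ)) := by
      rw [Finset.mul_sum, ← Finset.sum_neg_distrib, ← Finset.sum_add_distrib]
      exact Finset.sum_congr rfl fun i _ => by ring
    rw [this, radialRate, angularRate]
    ring
  rw [e, htop]
  linarith

theorem sum_exp_le {n : ℕ} {l : ℝ} (hl : 0 ≤ l) :
    ∑ i ∈ Finset.range n, exp (((i:ℝ) - 1) * l) ≤ n * exp (((n:ℝ) - 2) * l) := by
  have : ∀ i ∈ Finset.range n, exp (((i:ℝ) - 1) * l) ≤ exp (((n:ℝ) - 2) * l) := by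
    intro i hi
    have : ((i:ℝ) + 1) ≤ n := by exact_mod_cast Finset.mem_range.1 hi
    refine exp_le_exp.2 (mul_le_mul_of_nonneg_right (by linarith) hl)
  simpa using Finset.sum_le_sum this

theorem sum_exp_le_of_le {n : ℕ} {l Λ : ℝ} (hl : -1 ≤ l) (hlΛ : l ≤ Λ) (hΛ : 1 ≤ Λ) :
    ∑ i ∈ Finset.range n, exp (((i:ℝ) - 1) * l) ≤ n * exp (n * Λ) := by
  have : ∀ i ∈ Finset.range n, exp (((i:ℝ) - 1) * l) ≤ exp (n * Λ) := by
    intro i hi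
    have h1 : ((i:ℝ) + 1) ≤ n := by exact_mod_cast Finset.mem_range.1 hi
    have h2 : (0:ℝ) ≤ i := Nat.cast_nonneg i
    refine exp_le_exp.2 ?_
    rcases le_total 0 l with h | h
    · have : n * l ≤ n * Λ := by gcongr
      nlinarith
    · nlinarith
  simpa using Finset.sum_le_sum this

theorem radialRate_pos_of_sin_small {n : ℕ} {M : ℝ} {p : ℕ → ℝ} (hp : ∀ i, |p i| ≤ M)
    {l θ χ : ℝ} {k : ℕ} (hχ : 2 * χ = ((n:ℝ) - 1) * θ - k * π) (hsin : sin χ ^ 2 ≤ 1 / 4)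
    (hl : 0 ≤ l) (hbig : 2 * (n * M) < exp l) :
    0 < (-1) ^ k * radialRate n p l θ := by
  have hM : 0 ≤ M := (abs_nonneg _).trans (hp 0)
  have hτ : |(-1 : ℝ) ^ k| = 1 := by simp
  have hψ : ((n:ℝ) - 1) * θ = 2 * χ + k * π := by rw [hχ]; ring
  have e3 : ((-1 : ℝ) ^ k) * (-1) ^ k = 1 := by rw [← mul_pow]; simp
  have htop : exp (((n:ℝ) - 1) * l) / 2 ≤
      (-1 : ℝ) ^ k * (exp (((n:ℝ) - 1) * l) * cos (((n:ℝ) - 1) * θ)) := by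
    rw [hψ, cos_add_nat_mul_pi, show ∀ a b : ℝ, (-1 : ℝ) ^ k * (a * ((-1) ^ k * b)) =
      ((-1 : ℝ) ^ k * (-1) ^ k) * (a * b) from fun a b => by ring, e3, one_mul, cos_two_mul,
      cos_sq']
    nlinarith [exp_pos (((n:ℝ) - 1) * l)]
  have hsum : -(M * ∑ i ∈ Finset.range n, exp (((i:ℝ) - 1) * l)) ≤ (-1 : ℝ) ^ k *
      ∑ i ∈ Finset.range n, p i * (exp (((i:ℝ) - 1) * l) * cos (((i:ℝ) - 1) * θ)) := by
    refine (abs_le.1 ?_).1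
    rw [abs_mul, hτ, one_mul, Finset.mul_sum]
    refine (Finset.abs_sum_le_sum_abs _ _).trans (Finset.sum_le_sum fun i _ => ?_)
    rw [abs_mul, abs_mul, abs_of_pos (exp_pos _)]
    calc _ ≤ M * (exp (((i:ℝ) - 1) * l) * 1) := by
          gcongr
          · exact hp i
          · exact abs_cos_le_one _
      _ = _ := by ring
  have h1 := mul_le_mul_of_nonneg_left (sum_exp_le (n := n) hl) hM
  have e : exp (((n:ℝ) - 1) * l) = exp (((n:ℝ) - 2) * l) * exp l := by
    rw [← exp_add]; congr 1; ring
  have h2 := mul_lt_mul_of_pos_left hbig (exp_pos (((n:ℝ) - 2) * l))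
  rw [radialRate, mul_add]
  linarith

theorem pos_of_ne_zero_of_pos {ω : ℝ} {g : ℝ → ℝ} (hg : ContinuousOn g (Icc 0 ω))
    (h : ∀ t ∈ Icc (0:ℝ) ω, g t ≠ 0) {a : ℝ} (ha : a ∈ Icc (0:ℝ) ω) (hga : 0 < g a) :
    ∀ t ∈ Icc (0:ℝ) ω, 0 < g t := by
  intro t ht
  by_contra hle
  obtain ⟨x, hx, hx0⟩ := isPreconnected_Icc.intermediate_value ht ha hg ⟨not_lt.1 hle, hga.le⟩
  exact h x hx hx0

theorem pos_of_periodic_of_crossing {ω : ℝ} (hω : 0 < ω) {g g' : ℝ → ℝ}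
    (hg : ∀ t ∈ Icc (0:ℝ) ω, HasDerivWithinAt g (g' t) (Icc (0:ℝ) ω) t) (hper : g ω = g 0)
    (σ : ℝ) (h : ∀ t ∈ Icc (0:ℝ) ω, g t = 0 → 0 < σ * g' t) {a : ℝ} (ha : a ∈ Icc (0:ℝ) ω)
    (hga : 0 < g a) : ∀ t ∈ Icc (0:ℝ) ω, 0 < g t := by
  refine pos_of_ne_zero_of_pos (fun t ht => (hg t ht).continuousWithinAt) ?_ ha hga
  intro t ht h0
  refine ne_zero_of_periodic_of_deriv_pos hω (g := fun t => σ * g t)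
    (fun t ht => (hg t ht).const_mul σ) (by simp only [hper]) ?_ t ht (by simp [h0])
  intro x hx hx0
  rcases mul_eq_zero.1 hx0 with hσ | hx0
  · have := h t ht h0
    simp [hσ] at this
  · exact h x hx hx0

theorem sub_le_of_periodic_of_deriv_ge {ω C : ℝ} (hC : 0 ≤ C) {f f' : ℝ → ℝ}
    (hf : ∀ t ∈ Icc (0:ℝ) ω, HasDerivWithinAt f (f' t) (Icc (0:ℝ) ω) t) (hper : f ω = f 0)
    (h : ∀ t ∈ Icc (0:ℝ) ω, -C ≤ f' t) {a b : ℝ} (ha : a ∈ Icc (0:ℝ) ω)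
    (hb : b ∈ Icc (0:ℝ) ω) : f a - f b ≤ C * ω := by
  have hmono : MonotoneOn (fun t => f t + C * t) (Icc 0 ω) := by
    have hd : ∀ t ∈ Icc (0:ℝ) ω,
        HasDerivWithinAt (fun t => f t + C * t) (f' t + C * 1) (Icc (0:ℝ) ω) t :=
      fun t ht => (hf t ht).add ((hasDerivWithinAt_id t _).const_mul C)
    refine monotoneOn_of_hasDerivWithinAt_nonneg (convex_Icc _ _)
      (fun t ht => (hd t ht).continuousWithinAt)
      (fun t ht => (hd t (interior_subset ht)).mono interior_subset) ?_
    intro t ht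
    linarith [h t (interior_subset ht)]
  have hω : 0 ≤ ω := ha.1.trans ha.2
  have h0 : (0:ℝ) ∈ Icc (0:ℝ) ω := ⟨le_rfl, hω⟩
  have h1 : ω ∈ Icc (0:ℝ) ω := ⟨hω, le_rfl⟩
  rcases le_total a b with hab | hab
  · have := hmono ha hb hab
    simp only at this
    nlinarith [ha.1, hb.2]
  · have h2 := hmono ha h1 ha.2
    have h3 := hmono h0 hb hb.1
    simp only at h2 h3
    nlinarith

theorem sin_le_sin_of_le_pi_sub {a θ : ℝ} (ha : 0 ≤ a) (h1 : a ≤ θ) (h2 : θ ≤ π - a) :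
    sin a ≤ sin θ := by
  rcases le_total θ (π / 2) with h | h
  · exact sin_le_sin_of_le_of_le_pi_div_two (by linarith [pi_pos]) h h1
  · rw [← sin_pi_sub θ]
    exact sin_le_sin_of_le_of_le_pi_div_two (by linarith [pi_pos]) (by linarith) (by linarith)

/-- A periodic solution in the upper half plane, in logarithmic polar coordinates, that starts
outside the barrier curve near the unit circle stays outside it and within one sector. -/
theorem exists_sector {n : ℕ} (hn : 4 ≤ n) {ω : ℝ} (hω : 0 < ω) {μ δ M σ ε K : ℝ}
    {p : ℝ → ℕ → ℝ} {l θ : ℝ → ℝ} (hσ : |σ| = 1)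
    (hp : ∀ t ∈ Icc (0:ℝ) ω, NearCoeffs n (sin (π / ((n:ℝ) - 2))) μ δ M σ (p t))
    (hs : 0 < sin (π / ((n:ℝ) - 2))) (hμ : 0 < μ) (hδ : 0 ≤ δ) (hε : 0 < ε) (hK : 1 ≤ K)
    (hKs : 2 ≤ K * sin (π / ((n:ℝ) - 2)) ^ 2)
    (hnK : n * (K * ε) ≤ 1) (hKμ : 4 * (K * ε) ≤ μ)
    (h1 : 8 * (K * ε) * (3 * n * (1 + n * M)) ≤ μ * sin (π / ((n:ℝ) - 2)) / n / 6)
    (h2 : 4 * (K * ε) * (2 * n * (M + 2)) ≤ μ * sin (π / ((n:ℝ) - 2)) / n / 6)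
    (h3 : 2 * μ * (K * ε) ≤ μ * sin (π / ((n:ℝ) - 2)) / n / 6) (h4 : 8 * n * δ < μ * ε)
    (h5 : n * δ < 2 * sin (π / ((n:ℝ) - 2)) * ε)
    (hl : ∀ t ∈ Icc (0:ℝ) ω,
      HasDerivWithinAt l (radialRate n (p t) (l t) (θ t)) (Icc (0:ℝ) ω) t)
    (hθ : ∀ t ∈ Icc (0:ℝ) ω,
      HasDerivWithinAt θ (angularRate n (p t) (l t) (θ t)) (Icc (0:ℝ) ω) t)
    (hlper : l ω = l 0) (hθper : θ ω = θ 0) (hθπ : ∀ t ∈ Icc (0:ℝ) ω, θ t ∈ Ioo 0 π)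
    {a : ℝ} (ha : a ∈ Icc (0:ℝ) ω) (hla : 1 < l a) :
    (∀ t ∈ Icc (0:ℝ) ω, -1 ≤ l t) ∧
      ∃ k : ℕ, ∀ t ∈ Icc (0:ℝ) ω, k * π ≤ ((n:ℝ) - 2) * θ t ∧
        ((n:ℝ) - 2) * θ t ≤ ((k:ℝ) + 1) * π := by
  have hn' : (4:ℝ) ≤ n := by exact_mod_cast hn
  set s := sin (π / ((n:ℝ) - 2)) with hsdef
  have hKε : 0 < K * ε := by positivity
  have hKε1 : K * ε ≤ 1 := by nlinarith
  have hεK : ε ≤ K * ε := by nlinarith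
  have hbar : ∀ t ∈ Icc (0:ℝ) ω, 0 < l t - ε * (K * sin (θ t) ^ 2 - 1) := by
    refine pos_of_periodic_of_crossing hω (g' := fun t => radialRate n (p t) (l t) (θ t) -
      ε * (K * (2 * sin (θ t) * cos (θ t))) * angularRate n (p t) (l t) (θ t)) ?_
      (by simp only [hlper, hθper]) σ ?_ ha ?_
    · intro t ht
      have := (hl t ht).sub (((((hθ t ht).sin.pow 2).const_mul K).sub_const 1).const_mul ε)
      refine this.congr_deriv ?_
      push_cast
      ring
    · intro t ht h0
      exact barrier_pos hn (hp t ht) hσ hs (sin_le_one _) hμ hδ hε hK hnK hKμ h1 h2 h3 h4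
        (sub_eq_zero.1 h0)
    · have : K * ε * sin (θ a) ^ 2 ≤ K * ε * 1 := by gcongr; exact sin_sq_le_one _
      nlinarith
  refine ⟨fun t ht => ?_, ?_⟩
  · have := hbar t ht
    have : 0 ≤ K * ε * sin (θ t) ^ 2 := by positivity
    nlinarith
  have hcross : ∀ j : ℕ, 1 ≤ j → j + 3 ≤ n → ∀ t ∈ Icc (0:ℝ) ω,
      ((n:ℝ) - 2) * θ t - j * π = 0 →
      0 < (-1) ^ j * (((n:ℝ) - 2) * angularRate n (p t) (l t) (θ t)) := by
    intro j hj1 hjn t ht h0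
    have hj1' : (1:ℝ) ≤ j := by exact_mod_cast hj1
    have hjn' : (j:ℝ) + 3 ≤ n := by exact_mod_cast hjn
    have hn2 : (0:ℝ) < n - 2 := by linarith
    have hsθ : s ≤ sin (θ t) := by
      refine sin_le_sin_of_le_pi_sub (div_nonneg pi_pos.le hn2.le) ?_ ?_
      · rw [div_le_iff₀ hn2]; nlinarith [pi_pos]
      · rw [le_sub_iff_add_le, ← le_sub_iff_add_le', div_le_iff₀ hn2]; nlinarith [pi_pos]
    have hlε : ε ≤ l t := by
      have h6 := hbar t ht
      have h7 : K * s ^ 2 ≤ K * sin (θ t) ^ 2 := by gcongr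
      nlinarith
    have := ray_pos hn (hp t ht) hs hμ (j := j) hlε hε (sub_eq_zero.1 h0) hsθ hδ h5
    have := mul_pos hn2 this
    linarith
  have hderiv : ∀ j : ℕ, ∀ t ∈ Icc (0:ℝ) ω, HasDerivWithinAt
      (fun t => ((n:ℝ) - 2) * θ t - j * π) (((n:ℝ) - 2) * angularRate n (p t) (l t) (θ t))
      (Icc (0:ℝ) ω) t := fun j t ht => ((hθ t ht).const_mul _).sub_const _
  have hn2 : (0:ℝ) < n - 2 := by linarith
  have hq0 : 0 ≤ ((n:ℝ) - 2) * θ a / π :=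
    div_nonneg (mul_nonneg hn2.le (hθπ a ha).1.le) pi_pos.le
  refine ⟨⌊((n:ℝ) - 2) * θ a / π⌋₊, ?_⟩
  set k := ⌊((n:ℝ) - 2) * θ a / π⌋₊ with hk
  have hk1 : k * π ≤ ((n:ℝ) - 2) * θ a := (le_div_iff₀ pi_pos).1 (Nat.floor_le hq0)
  have hk2 : ((n:ℝ) - 2) * θ a < ((k:ℝ) + 1) * π := (div_lt_iff₀ pi_pos).1 (Nat.lt_floor_add_one _)
  have hkn : k + 3 ≤ n := by
    have : (k:ℝ) < n - 2 := by
      by_contra hge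
      have := (hθπ a ha).2
      nlinarith [pi_pos]
    have : (k:ℝ) + 2 < n := by linarith
    have : k + 2 < n := by exact_mod_cast this
    omega
  intro t ht
  constructor
  · rcases Nat.eq_zero_or_pos k with h0 | h0
    · rw [h0, Nat.cast_zero, zero_mul]
      exact mul_nonneg hn2.le (hθπ t ht).1.le
    · have hne : ((n:ℝ) - 2) * θ a - k * π ≠ 0 :=
        ne_zero_of_periodic_of_deriv_pos hω
          (g := fun t => (-1) ^ k * (((n:ℝ) - 2) * θ t - k * π))
          (fun t ht => (hderiv k t ht).const_mul _) (by simp only [hθper])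
          (fun t ht h => hcross k h0 hkn t ht (by simpa using h)) a ha ∘ fun h => by simp [h]
      have := pos_of_periodic_of_crossing hω (hderiv k) (by simp only [hθper]) ((-1) ^ k)
        (hcross k h0 hkn) ha (lt_of_le_of_ne (sub_nonneg.2 hk1) hne.symm) t ht
      linarith
  · rcases hkn.eq_or_lt with h0 | h0
    · have : (k:ℝ) + 1 = n - 2 := by
        rw [← h0]; push_cast; ring
      rw [this]
      exact mul_le_mul_of_nonneg_left (hθπ t ht).2.le hn2.le
    · have := pos_of_periodic_of_crossing hω (fun t ht => (hderiv (k + 1) t ht).neg)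
        (by simp only [Pi.neg_apply, hθper]) (-(-1) ^ (k + 1)) (fun t ht h => by
          have := hcross (k + 1) (by omega) (by omega) t ht (neg_eq_zero.1 h)
          linarith) ha (by simp only [Pi.neg_apply]; push_cast; linarith) t ht
      simp only [Pi.neg_apply] at this
      push_cast at this
      linarith

/-- A periodic solution confined to one sector has bounded modulus. -/
theorem logRadius_le_of_sector {n : ℕ} (hn : 4 ≤ n) {ω : ℝ} (hω : 0 < ω) {M Λ C : ℝ}
    {p : ℝ → ℕ → ℝ} {l θ : ℝ → ℝ} {k : ℕ}
    (hp : ∀ t ∈ Icc (0:ℝ) ω, ∀ i, |p t i| ≤ M) (hΛ1 : 1 ≤ Λ)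
    (hΛ : 2 * (M * (1 + 2 * n) * n) < exp Λ) (hC : M * (1 + 2 * n) * (n * exp (n * Λ)) ≤ C)
    (hl : ∀ t ∈ Icc (0:ℝ) ω,
      HasDerivWithinAt l (radialRate n (p t) (l t) (θ t)) (Icc (0:ℝ) ω) t)
    (hθ : ∀ t ∈ Icc (0:ℝ) ω,
      HasDerivWithinAt θ (angularRate n (p t) (l t) (θ t)) (Icc (0:ℝ) ω) t)
    (hlper : l ω = l 0) (hθper : θ ω = θ 0) (hθπ : ∀ t ∈ Icc (0:ℝ) ω, θ t ∈ Ioo 0 π)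
    (hl1 : ∀ t ∈ Icc (0:ℝ) ω, -1 ≤ l t)
    (hsec : ∀ t ∈ Icc (0:ℝ) ω, k * π ≤ ((n:ℝ) - 2) * θ t ∧
        ((n:ℝ) - 2) * θ t ≤ ((k:ℝ) + 1) * π) :
    ∀ t ∈ Icc (0:ℝ) ω, l t ≤ Λ + C * ω + log 4 := by
  intro a ha
  by_contra! hla
  have hn' : (4:ℝ) ≤ n := by exact_mod_cast hn
  have h0ω : (0:ℝ) ∈ Icc (0:ℝ) ω := ⟨le_rfl, hω.le⟩
  have hM : 0 ≤ M := (abs_nonneg _).trans (hp 0 h0ω 0)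
  have hC0 : 0 ≤ C := le_trans (by positivity) hC
  have hlog4 : 0 < log 4 := log_pos (by norm_num)
  set χ : ℝ → ℝ := fun t => (((n:ℝ) - 1) * θ t - k * π) / 2 with hχdef
  have hχ : ∀ t, 2 * χ t = ((n:ℝ) - 1) * θ t - k * π := fun t => by rw [hχdef]; ring
  have hsθ : ∀ t ∈ Icc (0:ℝ) ω, 0 < sin (θ t) := fun t ht =>
    sin_pos_of_pos_of_lt_pi (hθπ t ht).1 (hθπ t ht).2
  have hsχ : ∀ t ∈ Icc (0:ℝ) ω, sin (θ t) / 2 ≤ sin (χ t) := fun t ht =>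
    sin_half_le_sin_of_sector (hθπ t ht) (hsec t ht).1 (hsec t ht).2 (hχ t)
  have hsχ0 : ∀ t ∈ Icc (0:ℝ) ω, 0 < sin (χ t) := fun t ht => by
    linarith [hsθ t ht, hsχ t ht]
  have hχper : χ ω = χ 0 := by simp only [hχdef, hθper]
  set τ : ℝ := (-1) ^ k with hτ
  set rate : ℝ → ℝ := fun t => τ * (-radialRate n (p t) (l t) (θ t) +
    cos (χ t) / sin (χ t) * angularRate n (p t) (l t) (θ t)) with hrate
  set f : ℝ → ℝ := fun t => τ * (-l t + 2 / ((n:ℝ) - 1) * log (sin (χ t))) with hf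
  have hfd : ∀ t ∈ Icc (0:ℝ) ω, HasDerivWithinAt f (rate t) (Icc (0:ℝ) ω) t := by
    intro t ht
    have h1 : HasDerivWithinAt χ (((n:ℝ) - 1) * angularRate n (p t) (l t) (θ t) / 2)
      (Icc (0:ℝ) ω) t := (((hθ t ht).const_mul _).sub_const _).div_const 2
    have h2 := ((hl t ht).neg.add
      ((h1.sin.log (hsχ0 t ht).ne').const_mul (2 / ((n:ℝ) - 1)))).const_mul τ
    refine h2.congr_deriv ?_
    have h3 : (n:ℝ) - 1 ≠ 0 := by linarith
    have h4 := (hsχ0 t ht).ne'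
    simp only [hrate]
    field_simp
  have hfper : f ω = f 0 := by simp only [hf, hlper, hχper]
  have hratele : ∀ t ∈ Icc (0:ℝ) ω, exp (((n:ℝ) - 1) * l t) -
      M * (1 + 2 * n) * ∑ i ∈ Finset.range n, exp (((i:ℝ) - 1) * l t) ≤ rate t := fun t ht =>
    le_sectorRate (by omega) (hp t ht) (hχ t) (hsθ t ht) (hsχ t ht)
  have hratepos : ∀ t ∈ Icc (0:ℝ) ω, Λ ≤ l t → 0 < rate t := by
    intro t ht hlt
    refine lt_of_lt_of_le ?_ (hratele t ht)
    have h1 := mul_le_mul_of_nonneg_left (sum_exp_le (n := n) (l := l t) (by linarith))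
      (by positivity : 0 ≤ M * (1 + 2 * n))
    have e : exp (((n:ℝ) - 1) * l t) = exp (((n:ℝ) - 2) * l t) * exp (l t) := by
      rw [← exp_add]; congr 1; ring
    have h2 : M * (1 + 2 * n) * n < exp (l t) := by
      have : 0 ≤ M * (1 + 2 * n) * n := by positivity
      linarith [exp_le_exp.2 hlt]
    have h3 := mul_lt_mul_of_pos_left h2 (exp_pos (((n:ℝ) - 2) * l t))
    linarith
  have hratege : ∀ t ∈ Icc (0:ℝ) ω, -C ≤ rate t := by
    intro t ht
    rcases le_total Λ (l t) with h | h
    · linarith [hratepos t ht h]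
    · have h1 := mul_le_mul_of_nonneg_left (sum_exp_le_of_le (n := n) (hl1 t ht) h hΛ1)
        (by positivity : 0 ≤ M * (1 + 2 * n))
      linarith [hratele t ht, exp_pos (((n:ℝ) - 1) * l t)]
  have hfle : ∀ t ∈ Icc (0:ℝ) ω, |f t - f a| ≤ C * ω := fun t ht => by
    have h1 := sub_le_of_periodic_of_deriv_ge hC0 hfd hfper hratege ht ha
    have h2 := sub_le_of_periodic_of_deriv_ge hC0 hfd hfper hratege ha ht
    exact abs_le.2 ⟨by linarith, h1⟩
  have hsmall : ∀ t ∈ Icc (0:ℝ) ω, l t = Λ → sin (χ t) ^ 2 ≤ 1 / 4 := by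
    intro t ht hlt
    have h1 := hfle t ht
    rw [hf] at h1
    simp only at h1
    rw [← mul_sub, abs_mul, hτ, abs_pow, abs_neg, abs_one, one_pow, one_mul] at h1
    have h2 := (abs_le.1 h1).2
    have h3 : log (sin (χ a)) ≤ 0 := log_nonpos (hsχ0 a ha).le (sin_le_one _)
    have h4 : 2 / ((n:ℝ) - 1) * log (sin (χ a)) ≤ 0 :=
      mul_nonpos_of_nonneg_of_nonpos (div_nonneg (by norm_num) (by linarith)) h3
    have h5 : 2 / ((n:ℝ) - 1) * log (sin (χ t)) ≤ -log 4 := by linarith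
    have hn1 : (0:ℝ) < n - 1 := by linarith
    rw [div_mul_eq_mul_div, div_le_iff₀ hn1] at h5
    have h6 : 2 * log (sin (χ t)) ≤ -log 4 := by nlinarith
    have h7 : log (sin (χ t) ^ 2) ≤ log (1 / 4) := by
      rw [log_pow, one_div, log_inv]; exact_mod_cast h6
    exact (log_le_log_iff (pow_pos (hsχ0 t ht) 2) (by norm_num)).1 h7
  have hlΛ : ∀ t ∈ Icc (0:ℝ) ω, 0 < l t - Λ := by
    refine pos_of_periodic_of_crossing hω (fun t ht => (hl t ht).sub_const Λ)
      (by simp only [hlper]) τ ?_ ha (by nlinarith)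
    intro t ht h0
    have h0 : l t = Λ := sub_eq_zero.1 h0
    refine radialRate_pos_of_sin_small (hp t ht) (hχ t) (hsmall t ht h0) (by linarith) ?_
    rw [h0]
    have : 0 ≤ M * (2 * n) * n := by positivity
    linarith
  refine ne_zero_of_periodic_of_deriv_pos hω (fun t ht => (hfd t ht).sub_const (f 0))
    (by simp only [hfper]) (fun t ht _ => hratepos t ht (by linarith [hlΛ t ht])) 0 h0ω (sub_self _)

theorem exists_logRadius_bound {n : ℕ} (hn : 4 ≤ n) {ω μ M : ℝ} (hω : 0 < ω) (hμ : 0 < μ)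
    (hM : 0 ≤ M) :
    ∃ δ > 0, ∃ R : ℝ, ∀ (σ : ℝ) (p : ℝ → ℕ → ℝ) (l θ : ℝ → ℝ), |σ| = 1 →
      (∀ t ∈ Icc (0:ℝ) ω, NearCoeffs n (sin (π / ((n:ℝ) - 2))) μ δ M σ (p t)) →
      (∀ t ∈ Icc (0:ℝ) ω,
        HasDerivWithinAt l (radialRate n (p t) (l t) (θ t)) (Icc (0:ℝ) ω) t) →
      (∀ t ∈ Icc (0:ℝ) ω,
        HasDerivWithinAt θ (angularRate n (p t) (l t) (θ t)) (Icc (0:ℝ) ω) t) →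
      l ω = l 0 → θ ω = θ 0 → (∀ t ∈ Icc (0:ℝ) ω, θ t ∈ Ioo 0 π) →
      ∀ t ∈ Icc (0:ℝ) ω, l t ≤ R := by
  have hn' : (4:ℝ) ≤ n := by exact_mod_cast hn
  have hs : 0 < sin (π / ((n:ℝ) - 2)) := by
    refine sin_pos_of_pos_of_lt_pi (div_pos pi_pos (by linarith)) ?_
    rw [div_lt_iff₀ (by linarith)]
    nlinarith [pi_pos]
  set s := sin (π / ((n:ℝ) - 2)) with hsdef
  have hs1 : s ≤ 1 := sin_le_one _
  have small : ∀ a b : ℝ, 0 < b → ∀ᶠ y in nhdsWithin (0:ℝ) (Ioi 0), y * a < b := by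
    intro a b hb
    have : Tendsto (fun y : ℝ => y * a) (nhdsWithin (0:ℝ) (Ioi 0)) (nhds (0 * a)) :=
      ((continuous_id.mul continuous_const).tendsto 0).mono_left nhdsWithin_le_nhds
    rw [zero_mul] at this
    exact this.eventually_lt_const hb
  have hc : 0 < μ * s / n / 6 := by positivity
  obtain ⟨y, ⟨⟨⟨⟨⟨hy1, hy2⟩, hy3⟩, hy4⟩, hy5⟩, hy0⟩⟩ := ((((((small n 1 one_pos).and
    (small 4 μ hμ)).and (small (8 * (3 * n * (1 + n * M))) _ hc)).and
    (small (4 * (2 * n * (M + 2))) _ hc)).and (small (2 * μ) _ hc)).and self_mem_nhdsWithin).exists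
  have hy0 : 0 < y := hy0
  set K := 2 / s ^ 2 with hK
  have hKs : K * s ^ 2 = 2 := by rw [hK]; field_simp
  have hK1 : 1 ≤ K := by rw [hK, le_div_iff₀ (by positivity)]; nlinarith
  have hK0 : 0 < K := by linarith
  have hε : 0 < y / K := by positivity
  have hKε : K * (y / K) = y := by field_simp
  obtain ⟨δ, ⟨hδ1, hδ2⟩, hδ0⟩ := (((small (8 * n) (μ * (y / K)) (by positivity)).and
    (small n (2 * s * (y / K)) (by positivity))).and self_mem_nhdsWithin).exists
  have hδ0 : 0 < δ := hδ0
  obtain ⟨Λ, hΛ, hΛ1⟩ := ((tendsto_exp_atTop.eventually_gt_atTop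
    (2 * (M * (1 + 2 * n) * n))).and (eventually_ge_atTop 1)).exists
  have hC : 0 ≤ M * (1 + 2 * n) * (n * exp (n * Λ)) := by positivity
  refine ⟨δ, hδ0, Λ + M * (1 + 2 * n) * (n * exp (n * Λ)) * ω + log 4, ?_⟩
  intro σ p l θ hσ hp hl hθ hlper hθper hθπ
  by_cases hex : ∃ a ∈ Icc (0:ℝ) ω, 1 < l a
  · obtain ⟨a, ha, hla⟩ := hex
    obtain ⟨hl1, k, hk⟩ := exists_sector hn hω hσ hp hs hμ hδ0.le hε hK1 hKs.ge
      (by rw [hKε]; linarith) (by rw [hKε]; linarith) (by rw [hKε]; linarith)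
      (by rw [hKε]; linarith) (by rw [hKε]; linarith) (by linarith) (by linarith)
      hl hθ hlper hθper hθπ ha hla
    exact logRadius_le_of_sector hn hω (fun t ht => (hp t ht).bdd) hΛ1 hΛ le_rfl hl hθ hlper hθper
      hθπ hl1 hk
  · push Not at hex
    intro t ht
    have : 0 ≤ log 4 := log_nonneg (by norm_num)
    have := hex t ht
    nlinarith

/-- The coordinatewise projection of `ℂ` onto the square of half-side `R`. -/
def clampSquare (R : ℝ) (z : ℂ) : ℂ :=
  ⟨max (-R) (min R z.re), max (-R) (min R z.im)⟩

theorem norm_clampSquare_le {R : ℝ} (hR : 0 ≤ R) (z : ℂ) : ‖clampSquare R z‖ ≤ 2 * R := by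
  have h : ∀ x : ℝ, |max (-R) (min R x)| ≤ R := fun x =>
    abs_le.2 ⟨le_max_left _ _, max_le (by linarith) (min_le_left _ _)⟩
  have h1 := h z.re
  have h2 := h z.im
  have h3 := Complex.norm_le_abs_re_add_abs_im (clampSquare R z)
  simp only [clampSquare] at h3 ⊢
  linarith

theorem clampSquare_of_norm_le {R : ℝ} {z : ℂ} (hz : ‖z‖ ≤ R) : clampSquare R z = z := by
  have h1 := abs_le.1 ((Complex.abs_re_le_norm z).trans hz)
  have h2 := abs_le.1 ((Complex.abs_im_le_norm z).trans hz)
  apply Complex.ext <;> simp [clampSquare, h1, h2]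

theorem lipschitzWith_clampSquare (R : ℝ) : LipschitzWith 2 (clampSquare R) := by
  refine LipschitzWith.of_dist_le_mul fun z w => ?_
  have h : ∀ x y : ℝ, |max (-R) (min R x) - max (-R) (min R y)| ≤ |x - y| := fun x y => by
    have h1 := abs_max_sub_max_le_abs (min R x) (min R y) (-R)
    have h2 := abs_min_sub_min_le_max R x R y
    rw [sub_self, abs_zero, max_eq_right (abs_nonneg _)] at h2
    rw [max_comm (-R), max_comm (-R)]
    exact h1.trans h2
  rw [dist_eq_norm, dist_eq_norm]
  have h3 := Complex.norm_le_abs_re_add_abs_im (clampSquare R z - clampSquare R w)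
  have h4 := (h z.re w.re).trans (Complex.abs_re_le_norm (z - w))
  have h5 := (h z.im w.im).trans (Complex.abs_im_le_norm (z - w))
  simp only [clampSquare, Complex.sub_re, Complex.sub_im] at h3 ⊢
  push_cast
  linarith

theorem hasDerivWithinAt_Ici_of_Icc {E : Type*} [NormedAddCommGroup E] [NormedSpace ℝ E]
    {f : ℝ → E} {f' : E} {a b c t : ℝ} (hf : HasDerivWithinAt f f' (Icc a b) t) (hc : a ≤ c)
    (ht : t ∈ Ico c b) : HasDerivWithinAt f f' (Ici t) t :=
  hf.mono_of_mem_nhdsWithin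
    (mem_of_superset (Icc_mem_nhdsGE ht.2) (Icc_subset_Icc_left (hc.trans ht.1)))

/-- Uniformly bounded approximate solutions with convergent initial values yield a global
solution. -/
theorem exists_solution_of_approx {ω : ℝ} (hω : 0 < ω) {v : ℝ → ℂ → ℂ} {K : NNReal} {R L : ℝ}
    (hR : 0 ≤ R) (hv : ∀ t ∈ Icc (0:ℝ) ω, LipschitzOnWith K (v t) (Metric.closedBall 0 (2 * R)))
    (hvc : ∀ z, ContinuousOn (fun t => v t z) (Icc 0 ω))
    (hvL : ∀ t ∈ Icc (0:ℝ) ω, ∀ z, ‖z‖ ≤ 2 * R → ‖v t z‖ ≤ L)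
    {y y' : ℕ → ℝ → ℂ} (hy : ∀ j, ∀ t ∈ Icc (0:ℝ) ω,
      HasDerivWithinAt (y j) (y' j t) (Icc 0 ω) t)
    (hbound : ∀ᶠ j in atTop, ∀ t ∈ Icc (0:ℝ) ω, ‖y j t‖ ≤ R)
    (happrox : ∀ ε > 0, ∀ᶠ j in atTop, ∀ t ∈ Icc (0:ℝ) ω, ‖y' j t - v t (y j t)‖ ≤ ε)
    {c : ℂ} (hc : Tendsto (fun j => y j 0) atTop (nhds c)) :
    ∃ z : ℝ → ℂ, z 0 = c ∧ ∀ t ∈ Icc (0:ℝ) ω, HasDerivWithinAt z (v t (z t)) (Icc 0 ω) t := by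
  set w : ℝ → ℂ → ℂ := fun t z => v t (clampSquare R z) with hw
  have h0ω : (0:ℝ) ∈ Icc (0:ℝ) ω := ⟨le_rfl, hω.le⟩
  have hL : 0 ≤ L := (norm_nonneg _).trans (hvL 0 h0ω 0 (by simpa using hR))
  have hwl : ∀ t ∈ Icc (0:ℝ) ω, LipschitzWith (K * 2) (w t) := by
    intro t ht
    rw [← lipschitzOnWith_univ]
    exact (hv t ht).comp (lipschitzWith_clampSquare R).lipschitzOnWith fun z _ => by
      simpa using norm_clampSquare_le hR z
  have hpl : IsPicardLindelof w (⟨0, h0ω⟩ : Icc (0:ℝ) ω) c (L.toNNReal * ω.toNNReal) 0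
      L.toNNReal (K * 2) :=
    { lipschitzOnWith := fun t ht => (hwl t ht).lipschitzOnWith
      continuousOn := fun x _ => hvc _
      norm_le := fun t ht x _ => by
        rw [Real.coe_toNNReal _ hL]
        exact hvL t ht _ (norm_clampSquare_le hR x)
      mul_max_le := by
        simp [Real.coe_toNNReal _ hL, Real.coe_toNNReal _ hω.le, hω.le] }
  obtain ⟨z, hz0, hz⟩ := hpl.exists_eq_forall_mem_Icc_hasDerivWithinAt₀
  have hz0 : z 0 = c := hz0
  have hconv : ∀ t ∈ Icc (0:ℝ) ω, Tendsto (fun j => y j t) atTop (nhds (z t)) := by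
    intro t ht
    rw [Metric.tendsto_atTop']
    intro ε hε
    set k : NNReal := K * 2 + 1 with hk
    have hk0 : (k:ℝ) ≠ 0 := by rw [hk]; positivity
    have hlim : Tendsto (fun η : ℝ => gronwallBound η k η t) (nhdsWithin 0 (Ioi 0)) (nhds 0) := by
      simp only [gronwallBound_of_K_ne_0 hk0]
      have : Continuous fun η : ℝ => η * exp (k * t) + η / k * (exp (k * t) - 1) := by fun_prop
      have := this.tendsto 0
      simp only [zero_mul, zero_div, add_zero] at this
      exact this.mono_left nhdsWithin_le_nhds
    obtain ⟨η, hη, hη0⟩ := ((hlim.eventually_lt_const hε).and self_mem_nhdsWithin).exists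
    have hη0 : 0 < η := hη0
    obtain ⟨N, hN⟩ := eventually_atTop.1 ((hbound.and (happrox η hη0)).and
      (hc.eventually (Metric.closedBall_mem_nhds c hη0)))
    refine ⟨N, fun j hj => ?_⟩
    obtain ⟨⟨hb, ha⟩, hd⟩ := hN j hj.le
    refine lt_of_le_of_lt ?_ hη
    have := dist_le_of_approx_trajectories_ODE_of_mem (v := w) (s := fun _ => univ) (K := k)
      (f := y j) (g := z) (f' := y' j) (g' := fun t => w t (z t)) (a := 0) (b := ω) (εf := η)
      (εg := 0) (δ := η)
      (fun t ht => ((hwl t (Ico_subset_Icc_self ht)).weaken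
        (by rw [hk]; exact le_self_add)).lipschitzOnWith)
      (fun t ht => (hy j t ht).continuousWithinAt)
      (fun t ht => hasDerivWithinAt_Ici_of_Icc (hy j t (Ico_subset_Icc_self ht)) le_rfl ht)
      (fun t ht => by
        simp only [hw, clampSquare_of_norm_le (hb t (Ico_subset_Icc_self ht)), dist_eq_norm]
        exact ha t (Ico_subset_Icc_self ht))
      (fun _ _ => mem_univ _) (fun t ht => (hz t ht).continuousWithinAt)
      (fun t ht => hasDerivWithinAt_Ici_of_Icc (hz t (Ico_subset_Icc_self ht)) le_rfl ht)
      (fun t _ => (dist_self _).le) (fun _ _ => mem_univ _) (by rw [hz0]; exact hd) t ht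
    simpa using this
  refine ⟨z, hz0, fun t ht => ?_⟩
  have hzR : ‖z t‖ ≤ R :=
    le_of_tendsto (hconv t ht).norm (hbound.mono fun j hj => hj t ht)
  simpa only [hw, clampSquare_of_norm_le hzR] using hz t ht

theorem exists_lipschitzOnWith_rhsC (n : ℕ) {M R : ℝ} (hM : 0 ≤ M) (hR : 0 ≤ R) :
    ∃ K : NNReal, ∀ (P : Fin n → ℝ → ℝ) (t : ℝ), (∀ i, |P i t| ≤ M) →
      LipschitzOnWith K (rhsC n P t) (Metric.closedBall 0 R) := by
  refine ⟨(n * R ^ (n - 1) + ∑ i : Fin n, M * (i * R ^ ((i:ℕ) - 1))).toNNReal, fun P t hP => ?_⟩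
  refine Convex.lipschitzOnWith_of_nnnorm_hasDerivWithin_le (𝕜 := ℂ)
    (f' := fun z => n * z ^ (n - 1) + ∑ i : Fin n, (P i t : ℂ) * (i * z ^ ((i:ℕ) - 1)))
    (convex_closedBall _ _) (fun z _ => HasDerivAt.hasDerivWithinAt ?_) fun z hz => ?_
  · exact (hasDerivAt_pow n z).add
      (HasDerivAt.fun_sum fun i _ => (hasDerivAt_pow (i:ℕ) z).const_mul _)
  · rw [← NNReal.coe_le_coe, coe_nnnorm, Real.coe_toNNReal _ (by positivity)]
    have hz : ‖z‖ ≤ R := by simpa using hz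
    refine (norm_add_le _ _).trans (add_le_add ?_ ((norm_sum_le _ _).trans
      (Finset.sum_le_sum fun i _ => ?_)))
    · rw [norm_mul, norm_pow, Complex.norm_natCast]
      gcongr
    · rw [norm_mul, norm_mul, norm_pow, Complex.norm_natCast, Complex.norm_real, Real.norm_eq_abs]
      gcongr
      exact hP i

theorem norm_rhsC_le {n : ℕ} {M R : ℝ} {P : Fin n → ℝ → ℝ} {t : ℝ}
    (hP : ∀ i, |P i t| ≤ M) {z : ℂ} (hz : ‖z‖ ≤ R) :
    ‖rhsC n P t z‖ ≤ R ^ n + ∑ i : Fin n, M * R ^ (i:ℕ) := by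
  refine (norm_add_le _ _).trans (add_le_add ?_ ((norm_sum_le _ _).trans
    (Finset.sum_le_sum fun i _ => ?_)))
  · rw [norm_pow]
    gcongr
  · rw [norm_mul, norm_pow, Complex.norm_real, Real.norm_eq_abs]
    gcongr
    · exact (abs_nonneg _).trans (hP i)
    · exact hP i

theorem norm_rhsC_sub_rhsC_le {n : ℕ} {η R : ℝ} {P Q : Fin n → ℝ → ℝ} {t : ℝ}
    (hPQ : ∀ i, |P i t - Q i t| ≤ η) {z : ℂ} (hz : ‖z‖ ≤ R) :
    ‖rhsC n P t z - rhsC n Q t z‖ ≤ η * ∑ i : Fin n, R ^ (i:ℕ) := by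
  rw [rhsC, rhsC, add_sub_add_left_eq_sub, ← Finset.sum_sub_distrib, Finset.mul_sum]
  refine (norm_sum_le _ _).trans (Finset.sum_le_sum fun i _ => ?_)
  rw [← sub_mul, norm_mul, norm_pow, ← Complex.ofReal_sub, Complex.norm_real, Real.norm_eq_abs]
  gcongr
  · exact (abs_nonneg _).trans (hPQ i)
  · exact hPQ i

theorem conj_rhsC (n : ℕ) (P : Fin n → ℝ → ℝ) (t : ℝ) (z : ℂ) :
    (starRingEnd ℂ) (rhsC n P t z) = rhsC n P t ((starRingEnd ℂ) z) := by
  simp [rhsC, map_sum]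

theorem IsPeriodicC.conj {n : ℕ} {ω : ℝ} {P : Fin n → ℝ → ℝ} {z : ℝ → ℂ}
    (hz : IsPeriodicC n ω P z) : IsPeriodicC n ω P (fun t => (starRingEnd ℂ) (z t)) := by
  refine ⟨fun t ht => ?_, congrArg _ hz.2⟩
  rw [← conj_rhsC]
  exact (hz.1 t ht).star

theorem IsSolC.continuousOn {n : ℕ} {ω : ℝ} {P : Fin n → ℝ → ℝ} {z : ℝ → ℂ}
    (hz : IsSolC n ω P z) : ContinuousOn z (Icc 0 ω) := fun t ht => (hz t ht).continuousWithinAt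

theorem HasDerivWithinAt.complex_re {z : ℝ → ℂ} {z' : ℂ} {s : Set ℝ} {t : ℝ}
    (hz : HasDerivWithinAt z z' s t) : HasDerivWithinAt (fun t => (z t).re) z'.re s t :=
  Complex.reCLM.hasFDerivAt.comp_hasDerivWithinAt t hz

theorem HasDerivWithinAt.complex_im {z : ℝ → ℂ} {z' : ℂ} {s : Set ℝ} {t : ℝ}
    (hz : HasDerivWithinAt z z' s t) : HasDerivWithinAt (fun t => (z t).im) z'.im s t :=
  Complex.imCLM.hasFDerivAt.comp_hasDerivWithinAt t hz

/-- A periodic solution which is real at one time is real at all times. -/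
theorem IsPeriodicC.im_eq_zero {n : ℕ} {ω M : ℝ} (hM : 0 ≤ M) {P : Fin n → ℝ → ℝ} {z : ℝ → ℂ}
    (hz : IsPeriodicC n ω P z) (hP : ∀ t ∈ Icc (0:ℝ) ω, ∀ i, |P i t| ≤ M) {t₀ : ℝ}
    (ht₀ : t₀ ∈ Icc (0:ℝ) ω) (h0 : (z t₀).im = 0) : ∀ t ∈ Icc (0:ℝ) ω, (z t).im = 0 := by
  obtain ⟨C, hC⟩ := isCompact_Icc.exists_bound_of_continuousOn hz.1.continuousOn
  obtain ⟨K, hK⟩ := exists_lipschitzOnWith_rhsC n hM (R := C) ((norm_nonneg _).trans (hC _ ht₀))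
  have key : ∀ a ∈ Icc (0:ℝ) ω, (z a).im = 0 → ∀ t ∈ Icc a ω, (z t).im = 0 := by
    intro a ha ha0
    refine eq_zero_of_abs_deriv_le_mul_abs_self_of_eq_zero_right (K := K)
      (f' := fun t => (rhsC n P t (z t)).im)
      (fun t ht => ((hz.1 t ⟨ha.1.trans ht.1, ht.2⟩).complex_im.continuousWithinAt).mono
        (Icc_subset_Icc_left ha.1))
      (fun t ht => hasDerivWithinAt_Ici_of_Icc (hz.1 t ⟨ha.1.trans ht.1, ht.2.le⟩).complex_im
        ha.1 ht) ha0 fun t ht => ?_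
    have ht' : t ∈ Icc (0:ℝ) ω := ⟨ha.1.trans ht.1, ht.2.le⟩
    have := (hK P t (hP t ht')).norm_sub_le (x := z t) (y := (starRingEnd ℂ) (z t))
      (by simpa using hC t ht') (by simpa using hC t ht')
    rw [← conj_rhsC, Complex.sub_conj, Complex.sub_conj] at this
    simp only [Complex.ofReal_mul, Complex.ofReal_ofNat, norm_mul, Complex.norm_ofNat,
      Complex.norm_real, Complex.norm_I, mul_one] at this
    linarith
  have hω := ht₀.1.trans ht₀.2
  refine key 0 ⟨le_rfl, hω⟩ ?_
  rw [← hz.2]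
  exact key t₀ ht₀ h0 ω ⟨ht₀.2, le_rfl⟩

/-- The coefficients of (1.1) at time `t`, extended by zero. -/
def coeffs {n : ℕ} (P : Fin n → ℝ → ℝ) (t : ℝ) (i : ℕ) : ℝ :=
  if h : i < n then P ⟨i, h⟩ t else 0

theorem coeffs_of_lt {n : ℕ} (P : Fin n → ℝ → ℝ) (t : ℝ) {i : ℕ} (h : i < n) :
    coeffs P t i = P ⟨i, h⟩ t := dif_pos h

theorem abs_coeffs_le {n : ℕ} {P : Fin n → ℝ → ℝ} {t M : ℝ} (hM : 0 ≤ M)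
    (hP : ∀ i, |P i t| ≤ M) (i : ℕ) : |coeffs P t i| ≤ M := by
  unfold coeffs
  split_ifs with h
  · exact hP _
  · simpa using hM

theorem rhsC_div_eq {n : ℕ} (P : Fin n → ℝ → ℝ) (t : ℝ) {z : ℂ} (hz : z ≠ 0) :
    rhsC n P t z / z = Complex.exp (((n:ℝ) - 1 : ℝ) * Complex.log z) +
      ∑ i ∈ Finset.range n, (coeffs P t i : ℂ) *
        Complex.exp (((i:ℝ) - 1 : ℝ) * Complex.log z) := by
  have h : ∀ i : ℕ, Complex.exp (((i:ℝ) - 1 : ℝ) * Complex.log z) = z ^ i / z := by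
    intro i
    push_cast
    rw [sub_mul, one_mul, Complex.exp_sub, Complex.exp_nat_mul, Complex.exp_log hz]
  simp only [h]
  rw [rhsC, add_div, Finset.sum_div, Finset.sum_range]
  congr 1
  refine Finset.sum_congr rfl fun i _ => ?_
  rw [coeffs_of_lt P t i.2, mul_div_assoc]

theorem re_exp_mul (a : ℝ) (w : ℂ) :
    (Complex.exp (a * w)).re = exp (a * w.re) * cos (a * w.im) := by
  simp [Complex.exp_re]

theorem im_exp_mul (a : ℝ) (w : ℂ) :
    (Complex.exp (a * w)).im = exp (a * w.re) * sin (a * w.im) := by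
  simp [Complex.exp_im]

theorem re_rhsC_div {n : ℕ} (P : Fin n → ℝ → ℝ) (t : ℝ) {z : ℂ} (hz : z ≠ 0) :
    (rhsC n P t z / z).re =
      radialRate n (coeffs P t) (Complex.log z).re (Complex.log z).im := by
  rw [rhsC_div_eq P t hz, radialRate, Complex.add_re, Complex.re_sum, re_exp_mul]
  simp only [Complex.re_ofReal_mul, re_exp_mul]

theorem im_rhsC_div {n : ℕ} (P : Fin n → ℝ → ℝ) (t : ℝ) {z : ℂ} (hz : z ≠ 0) :
    (rhsC n P t z / z).im =
      angularRate n (coeffs P t) (Complex.log z).re (Complex.log z).im := by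
  rw [rhsC_div_eq P t hz, angularRate, Complex.add_im, Complex.im_sum, im_exp_mul]
  simp only [Complex.im_ofReal_mul, im_exp_mul]

theorem IsSolC.hasDerivWithinAt_log {n : ℕ} {ω : ℝ} {P : Fin n → ℝ → ℝ} {z : ℝ → ℂ}
    (hz : IsSolC n ω P z) {t : ℝ} (ht : t ∈ Icc (0:ℝ) ω) (him : 0 < (z t).im) :
    HasDerivWithinAt (fun t => Complex.log (z t)) (rhsC n P t (z t) / z t) (Icc 0 ω) t :=
  (hz t ht).clog_real (Or.inr him.ne')

theorem log_im_mem_Ioo {z : ℂ} (hz : 0 < z.im) : (Complex.log z).im ∈ Ioo 0 π := by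
  rw [Complex.log_im]
  have h0 : Complex.arg z ≠ 0 := fun h => hz.ne' (Complex.arg_eq_zero_iff.1 h).2
  have hπ : Complex.arg z ≠ π := fun h => hz.ne' (Complex.arg_eq_pi_iff.1 h).2
  exact ⟨lt_of_le_of_ne (Complex.arg_nonneg_iff.2 hz.le) h0.symm,
    lt_of_le_of_ne (Complex.arg_le_pi z) hπ⟩

theorem abs_sum_mul_pow_le {n : ℕ} {M : ℝ} {p : Fin n → ℝ} (hp : ∀ i, |p i| ≤ M) {c : ℝ}
    (hc : 1 ≤ |c|) : |∑ i, p i * c ^ (i:ℕ)| ≤ n * M * |c| ^ (n - 1) := by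
  have : ∑ i : Fin n, M * |c| ^ (n - 1) = n * M * |c| ^ (n - 1) := by simp [mul_assoc]
  rw [← this]
  refine (Finset.abs_sum_le_sum_abs _ _).trans (Finset.sum_le_sum fun i _ => ?_)
  rw [abs_mul, abs_pow]
  have h1 : |c| ^ (i:ℕ) ≤ |c| ^ (n - 1) := pow_le_pow_right₀ hc (by omega)
  exact mul_le_mul (hp i) h1 (by positivity) ((abs_nonneg _).trans (hp i))

/-- Real periodic solutions are bounded. -/
theorem IsPeriodicC.abs_re_le {n : ℕ} (hn : 1 ≤ n) {ω M : ℝ} (hω : 0 < ω) (hM : 0 ≤ M)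
    {P : Fin n → ℝ → ℝ} {z : ℝ → ℂ} (hz : IsPeriodicC n ω P z)
    (hP : ∀ t ∈ Icc (0:ℝ) ω, ∀ i, |P i t| ≤ M) (him : ∀ t ∈ Icc (0:ℝ) ω, (z t).im = 0) :
    ∀ t ∈ Icc (0:ℝ) ω, |(z t).re| ≤ 1 + n * M := by
  intro t₀ ht₀
  by_contra! hlt
  set c := (z t₀).re with hc
  have hnM : 0 ≤ n * M := by positivity
  refine ne_zero_of_periodic_of_deriv_pos hω (g := fun t => c ^ n * ((z t).re - c))
    (g' := fun t => c ^ n * (rhsC n P t (z t)).re)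
    (fun t ht => ((hz.1 t ht).complex_re.sub_const c).const_mul _) (by simp only [hz.2])
    (fun t ht h => ?_) t₀ ht₀ (by simp [hc])
  have hc0 : c ≠ 0 := fun h => by rw [h, abs_zero] at hlt; linarith
  have hre : (z t).re = c := by
    rcases mul_eq_zero.1 h with h | h
    · exact absurd h (pow_ne_zero _ hc0)
    · linarith
  have hzc : z t = (c:ℂ) := Complex.ext hre (him t ht)
  have hval : (rhsC n P t (z t)).re = c ^ n + ∑ i, P i t * c ^ (i:ℕ) := by
    rw [hzc, rhsC]
    norm_cast
  rw [hval]
  have h1 := abs_sum_mul_pow_le (hP t ht) (c := c) (by linarith)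
  have h2 : |∑ i, P i t * c ^ (i:ℕ)| < |c| ^ n := by
    refine h1.trans_lt ?_
    obtain ⟨m, rfl⟩ : ∃ m, n = m + 1 := ⟨n - 1, by omega⟩
    rw [Nat.add_sub_cancel, pow_succ']
    have : 0 < |c| ^ m := pow_pos (abs_pos.2 hc0) _
    exact mul_lt_mul_of_pos_right (by linarith) this
  rw [← abs_pow] at h2
  have h3 : 0 < |c ^ n| := abs_pos.2 (pow_ne_zero _ hc0)
  have h4 : |c ^ n| * |∑ i, P i t * c ^ (i:ℕ)| < |c ^ n| * |c ^ n| :=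
    mul_lt_mul_of_pos_left h2 h3
  rw [← abs_mul, ← abs_mul, abs_mul_self] at h4
  have := neg_abs_le (c ^ n * ∑ i, P i t * c ^ (i:ℕ))
  rw [mul_add]
  linarith

theorem nearCoeffs_of_near {n : ℕ} (hn : 4 ≤ n) (hn0 : 0 < n) (hn1 : 1 < n)
    (hnn : n - 1 < n) {P Q : Fin n → ℝ → ℝ} {t μ δ δ₀ M σ s : ℝ}
    (hs0 : 0 ≤ s) (hs1 : s ≤ 1) (hσ : |σ| = 1) (hM0 : 0 ≤ M)
    (hδ₀ : 4 * δ₀ ≤ δ) (hδμ : δ₀ ≤ μ) (hδ1 : δ₀ ≤ 1)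
    (hQ : ∀ i, |Q i t - P i t| ≤ δ₀) (hM : ∀ i, |P i t| ≤ M)
    (h0 : |P ⟨0, hn0⟩ t| ≤ 1 - 2 * μ)
    (ha : ∀ i : Fin n, (i:ℕ) ≠ 0 → (i:ℕ) ≠ 1 → (i:ℕ) ≠ n - 1 →
      |P i t| ≤ (1 - |P ⟨0, hn0⟩ t|) * s / ((n:ℝ) - 3))
    (hb : 1 + |P ⟨0, hn0⟩ t| + |P ⟨n - 1, hnn⟩ t| +
        (1 - |P ⟨0, hn0⟩ t|) * s ≤ σ * P ⟨1, hn1⟩ t) :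
    NearCoeffs n s μ δ (M + 1) σ (coeffs Q t) := by
  have hn' : (4:ℝ) ≤ n := by exact_mod_cast hn
  have hdiff : ∀ i, |Q i t| ≤ |P i t| + δ₀ ∧ |P i t| ≤ |Q i t| + δ₀ := by
    intro i
    have h1 := (abs_sub_abs_le_abs_sub (Q i t) (P i t)).trans (hQ i)
    have h2 := (abs_sub_abs_le_abs_sub (P i t) (Q i t)).trans ((abs_sub_comm _ _).trans_le (hQ i))
    constructor <;> linarith
  have hδ : 0 ≤ δ₀ := (abs_nonneg _).trans (hQ ⟨0, hn0⟩)
  have e0 : coeffs Q t 0 = Q ⟨0, hn0⟩ t := coeffs_of_lt _ _ _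
  have e1 : coeffs Q t 1 = Q ⟨1, hn1⟩ t := coeffs_of_lt _ _ _
  have en : coeffs Q t (n - 1) = Q ⟨n - 1, hnn⟩ t := coeffs_of_lt _ _ _
  have d0 := hdiff ⟨0, hn0⟩
  have dn := hdiff ⟨n - 1, hnn⟩
  refine ⟨?_, fun i h2 hi => ?_, ?_, abs_coeffs_le (by linarith) fun i => ?_⟩
  · rw [e0]
    linarith
  · rw [e0, coeffs_of_lt Q t (show i < n by omega)]
    have h1 := (hdiff ⟨i, by omega⟩).1
    have h3 := ha ⟨i, by omega⟩ (by simp; omega) (by simp; omega) (by simp; omega)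
    have hr0 : 0 ≤ s / ((n:ℝ) - 3) := div_nonneg hs0 (by linarith)
    have hr1 : s / ((n:ℝ) - 3) ≤ 1 := by
      rw [div_le_one (by linarith)]
      linarith
    rw [mul_div_assoc] at h3 ⊢
    have h4 : (1 - |P ⟨0, hn0⟩ t|) * (s / ((n:ℝ) - 3)) ≤
        (1 - |Q ⟨0, hn0⟩ t| + δ₀) * (s / ((n:ℝ) - 3)) :=
      mul_le_mul_of_nonneg_right (by linarith) hr0
    have h5 : δ₀ * (s / ((n:ℝ) - 3)) ≤ δ₀ := mul_le_of_le_one_right hδ hr1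
    rw [add_mul] at h4
    linarith
  · rw [e0, en, e1]
    have h1 : σ * P ⟨1, hn1⟩ t - δ₀ ≤ σ * Q ⟨1, hn1⟩ t := by
      have h := (neg_abs_le (σ * (Q ⟨1, hn1⟩ t - P ⟨1, hn1⟩ t)))
      rw [abs_mul, hσ, one_mul, mul_sub] at h
      have := hQ ⟨1, hn1⟩
      linarith
    have h4 : (1 - |Q ⟨0, hn0⟩ t|) * s ≤ (1 - |P ⟨0, hn0⟩ t| + δ₀) * s :=
      mul_le_mul_of_nonneg_right (by linarith) hs0
    have h5 : δ₀ * s ≤ δ₀ := mul_le_of_le_one_right hδ hs1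
    rw [add_mul] at h4
    linarith
  · have := (hdiff i).1
    have := hM i
    linarith

theorem exists_bound_coeffs {n : ℕ} {ω : ℝ} {P : Fin n → ℝ → ℝ}
    (hP : ∀ i, ContinuousOn (P i) (Icc 0 ω)) :
    ∃ M, 0 ≤ M ∧ ∀ t ∈ Icc (0:ℝ) ω, ∀ i, |P i t| ≤ M := by
  choose C hC using fun i => isCompact_Icc.exists_bound_of_continuousOn (hP i)
  refine ⟨∑ i, |C i|, by positivity, fun t ht i => ?_⟩
  exact ((hC i t ht).trans (le_abs_self _)).trans
    (Finset.single_le_sum (f := fun i => |C i|) (fun _ _ => abs_nonneg _) (Finset.mem_univ i))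

theorem exists_sign {ω : ℝ} {g : ℝ → ℝ} (hω : 0 ≤ ω) (hg : ContinuousOn g (Icc 0 ω))
    (h : ∀ t ∈ Icc (0:ℝ) ω, g t ≠ 0) :
    ∃ σ : ℝ, |σ| = 1 ∧ ∀ t ∈ Icc (0:ℝ) ω, |g t| = σ * g t := by
  have h0 : (0:ℝ) ∈ Icc (0:ℝ) ω := ⟨le_rfl, hω⟩
  rcases (h 0 h0).lt_or_gt with hneg | hpos
  · refine ⟨-1, by simp, fun t ht => ?_⟩
    have := pos_of_ne_zero_of_pos hg.neg (fun t ht => neg_ne_zero.2 (h t ht)) h0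
      (neg_pos.2 hneg) t ht
    rw [abs_of_neg (neg_pos.1 this), neg_one_mul]
  · refine ⟨1, by simp, fun t ht => ?_⟩
    rw [abs_of_pos (pos_of_ne_zero_of_pos hg h h0 hpos t ht), one_mul]

/-- Periodic solutions of all equations near `P` are uniformly bounded. -/
theorem exists_periodic_bound
    {n : ℕ} (hn : 4 ≤ n) (hn0 : 0 < n) (hn1 : 1 < n)
    (hnn : n - 1 < n) {ω : ℝ} (hω : 0 < ω)
    (P : Fin n → ℝ → ℝ) (hP : ∀ i, ContinuousOn (P i) (Icc 0 ω))
    (hK : ∀ t ∈ Icc (0:ℝ) ω, |P ⟨0, hn0⟩ t| < 1)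
    (ha : ∀ t ∈ Icc (0:ℝ) ω, ∀ i : Fin n, (i:ℕ) ≠ 0 → (i:ℕ) ≠ 1 → (i:ℕ) ≠ n - 1 →
      |P i t| ≤ (1 - |P ⟨0, hn0⟩ t|) * sin (π / ((n:ℝ) - 2)) / ((n:ℝ) - 3))
    (hb : ∀ t ∈ Icc (0:ℝ) ω,
      1 + |P ⟨0, hn0⟩ t| + |P ⟨n - 1, hnn⟩ t| +
        (1 - |P ⟨0, hn0⟩ t|) * sin (π / ((n:ℝ) - 2)) ≤ |P ⟨1, hn1⟩ t|) :
    ∃ δ₀ > 0, ∃ R, 0 ≤ R ∧ ∀ Q : Fin n → ℝ → ℝ,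
      (∀ i, ∀ t ∈ Icc (0:ℝ) ω, |Q i t - P i t| ≤ δ₀) →
      ∀ z, IsPeriodicC n ω Q z → ∀ t ∈ Icc (0:ℝ) ω, ‖z t‖ ≤ R := by
  have hn' : (4:ℝ) ≤ n := by exact_mod_cast hn
  have h0ω : (0:ℝ) ∈ Icc (0:ℝ) ω := ⟨le_rfl, hω.le⟩
  have hs : 0 ≤ sin (π / ((n:ℝ) - 2)) := by
    refine sin_nonneg_of_nonneg_of_le_pi (div_nonneg pi_pos.le (by linarith)) ?_
    exact div_le_self pi_pos.le (by linarith)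
  obtain ⟨M, hM0, hM⟩ := exists_bound_coeffs hP
  obtain ⟨τ, hτ, hτmax⟩ := isCompact_Icc.exists_isMaxOn ⟨0, h0ω⟩ (hP ⟨0, hn0⟩).abs
  obtain ⟨μ, hμ⟩ : ∃ μ, μ = (1 - |P ⟨0, hn0⟩ τ|) / 2 := ⟨_, rfl⟩
  have hμ0 : 0 < μ := by
    have := hK τ hτ
    linarith
  have hP0 : ∀ t ∈ Icc (0:ℝ) ω, |P ⟨0, hn0⟩ t| ≤ 1 - 2 * μ := fun t ht => by
    have : |P ⟨0, hn0⟩ t| ≤ |P ⟨0, hn0⟩ τ| := hτmax ht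
    linarith
  obtain ⟨σ, hσ, hσP⟩ := exists_sign hω.le (hP ⟨1, hn1⟩) fun t ht h => by
    have h1 := hb t ht
    have h2 := mul_nonneg (sub_nonneg.2 (hK t ht).le) hs
    rw [h, abs_zero] at h1
    linarith [abs_nonneg (P ⟨0, hn0⟩ t), abs_nonneg (P ⟨n - 1, hnn⟩ t)]
  obtain ⟨δ, hδ, R, hR⟩ := exists_logRadius_bound hn hω hμ0 (add_nonneg hM0 zero_le_one)
  refine ⟨min (δ / 4) (min μ 1), by positivity, max (exp R) (1 + n * (M + 1)),
    (exp_pos R).le.trans (le_max_left _ _), fun Q hQ => ?_⟩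
  have hδ1 : min (δ / 4) (min μ 1) ≤ δ / 4 := min_le_left _ _
  have hδ2 : min (δ / 4) (min μ 1) ≤ μ := (min_le_right _ _).trans (min_le_left _ _)
  have hδ3 : min (δ / 4) (min μ 1) ≤ 1 := (min_le_right _ _).trans (min_le_right _ _)
  have hnear : ∀ t ∈ Icc (0:ℝ) ω,
      NearCoeffs n (sin (π / ((n:ℝ) - 2))) μ δ (M + 1) σ (coeffs Q t) := fun t ht =>
    nearCoeffs_of_near hn hn0 hn1 hnn hs (sin_le_one _) hσ hM0 (by linarith) hδ2 hδ3
      (fun i => hQ i t ht) (hM t ht) (hP0 t ht) (ha t ht) ((hb t ht).trans_eq (hσP t ht))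
  have hQM : ∀ t ∈ Icc (0:ℝ) ω, ∀ i, |Q i t| ≤ M + 1 := fun t ht i => by
    have := abs_sub_abs_le_abs_sub (Q i t) (P i t)
    linarith [hQ i t ht, hM t ht i]
  have upper : ∀ z, IsPeriodicC n ω Q z → (∀ t ∈ Icc (0:ℝ) ω, 0 < (z t).im) →
      ∀ t ∈ Icc (0:ℝ) ω, ‖z t‖ ≤ max (exp R) (1 + n * (M + 1)) := by
    intro z hz him t ht
    have hz0 : ∀ t ∈ Icc (0:ℝ) ω, z t ≠ 0 := fun t ht h => by simpa [h] using him t ht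
    have hl := hR σ (coeffs Q) (fun t => (Complex.log (z t)).re)
      (fun t => (Complex.log (z t)).im) hσ hnear
      (fun t ht => by
        rw [← re_rhsC_div Q t (hz0 t ht)]
        exact (hz.1.hasDerivWithinAt_log ht (him t ht)).complex_re)
      (fun t ht => by
        rw [← im_rhsC_div Q t (hz0 t ht)]
        exact (hz.1.hasDerivWithinAt_log ht (him t ht)).complex_im)
      (by simp only [hz.2]) (by simp only [hz.2]) (fun t ht => log_im_mem_Ioo (him t ht)) t ht
    rw [Complex.log_re] at hl
    refine le_max_of_le_left ?_
    rw [← exp_log (norm_pos_iff.2 (hz0 t ht))]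
    exact exp_le_exp.2 hl
  intro z hz
  by_cases hex : ∃ t ∈ Icc (0:ℝ) ω, (z t).im = 0
  · obtain ⟨t₀, ht₀, him0⟩ := hex
    have him := hz.im_eq_zero (add_nonneg hM0 zero_le_one) hQM ht₀ him0
    intro t ht
    refine le_max_of_le_right ?_
    rw [← Complex.abs_re_eq_norm.2 (him t ht)]
    exact hz.abs_re_le (by omega) hω (add_nonneg hM0 zero_le_one) hQM him t ht
  · push Not at hex
    have hcont : ContinuousOn (fun t => (z t).im) (Icc 0 ω) :=
      Complex.continuous_im.comp_continuousOn hz.1.continuousOn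
    rcases (hex 0 h0ω).lt_or_gt with hneg | hpos
    · intro t ht
      have := upper _ hz.conj (fun t ht => by
        rw [Complex.conj_im]
        exact pos_of_ne_zero_of_pos hcont.neg (fun t ht => neg_ne_zero.2 (hex t ht)) h0ω
          (neg_pos.2 hneg) t ht) t ht
      rwa [Complex.norm_conj] at this
    · exact upper z hz (pos_of_ne_zero_of_pos hcont hex h0ω hpos)

/-- Under the normalized (`K = 1`) hypotheses of Theorem 1.1, equation (1.1) has no
singular periodic solution, i.e. `P ∈ 𝓐`. -/
theorem no_singular_periodic_solution
    {n : ℕ} (hn : 4 ≤ n) {ω : ℝ} (hω : 0 < ω)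
    (P : Fin n → ℝ → ℝ) (hP : ∀ i, ContinuousOn (P i) (Icc 0 ω))
    (hK : ∀ t ∈ Icc (0:ℝ) ω, |P ⟨0, by omega⟩ t| < 1)
    (ha : ∀ t ∈ Icc (0:ℝ) ω, ∀ i : Fin n, (i:ℕ) ≠ 0 → (i:ℕ) ≠ 1 → (i:ℕ) ≠ n - 1 →
      |P i t| ≤ (1 - |P ⟨0, by omega⟩ t|) * sin (π / ((n:ℝ) - 2)) / ((n:ℝ) - 3))
    (hb : ∀ t ∈ Icc (0:ℝ) ω,
      1 + |P ⟨0, by omega⟩ t| + |P ⟨n-1, by omega⟩ t| +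
        (1 - |P ⟨0, by omega⟩ t|) * sin (π / ((n:ℝ) - 2)) ≤ |P ⟨1, by omega⟩ t|) :
    ¬ HasSingularPeriodicSol n ω P := by
  rintro ⟨Pj, cj, -, hconv, hper, halt⟩
  have h0ω : (0:ℝ) ∈ Icc (0:ℝ) ω := ⟨le_rfl, hω.le⟩
  choose z hz hz0 using hper
  obtain ⟨δ₀, hδ₀, R, hR, hbound⟩ := exists_periodic_bound hn (by omega) (by omega) (by omega)
    hω P hP hK ha hb
  have hev : ∀ᶠ j in atTop, ∀ t ∈ Icc (0:ℝ) ω, ‖z j t‖ ≤ R :=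
    (hconv δ₀ hδ₀).mono fun j hj => hbound (Pj j) hj (z j) (hz j)
  rcases halt with ⟨c, hc, hno⟩ | htop
  · refine hno ?_
    obtain ⟨M, hM0, hM⟩ := exists_bound_coeffs hP
    obtain ⟨K, hKl⟩ := exists_lipschitzOnWith_rhsC n hM0 (R := 2 * R) (by positivity)
    obtain ⟨y, hy0, hy⟩ := exists_solution_of_approx hω (v := rhsC n P) hR
      (fun t ht => hKl P t (hM t ht))
      (fun w => continuousOn_const.add (continuousOn_finsetSum _ fun i _ =>
        (Complex.continuous_ofReal.comp_continuousOn (hP i)).mul continuousOn_const))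
      (fun t ht w hw => norm_rhsC_le (hM t ht) hw)
      (fun j t ht => (hz j).1 t ht) hev
      (fun ε hε => by
        have hS : 0 ≤ ∑ i : Fin n, R ^ (i:ℕ) := by positivity
        filter_upwards [hev, hconv (ε / (∑ i : Fin n, R ^ (i:ℕ) + 1)) (by positivity)]
          with j hj hj' t ht
        refine (norm_rhsC_sub_rhsC_le (fun i => hj' i t ht) (hj t ht)).trans ?_
        rw [div_mul_eq_mul_div, div_le_iff₀ (by positivity)]
        exact mul_le_mul_of_nonneg_left (by linarith) hε.le)
      (by simpa only [hz0] using hc)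
    exact ⟨y, hy, hy0⟩
  · obtain ⟨j, hj, hj'⟩ := (hev.and (htop.eventually_gt_atTop R)).exists
    have := hj 0 h0ω
    rw [hz0] at this
    linarith
end
end
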